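/- Let d ≥ 2, let 1 ≤ k ≤ d−1 be an integer, and let h : (0,∞) → (0,∞) be a gauge function such that h(2t) ≤ 2^d h(t) for all t > 0 and ∫₀¹ t^{-1} √(t^{k-d} |log t| h(t)) dt < ∞. Then there exists a compact set A ⊂ ℝ^d with 0 < ℋ^h(A) < ∞ such that no Borel subset of A of positive ℋ^h-measure is G(d,k)-tube null. In particular, there exist sets of Hausdorff dimension d−k which are not G(d,k)-tube null. -/

import Mathlib

open MeasureTheory Metric Set
open scoped ENNReal NNReal

noncomputable section

/-- `ℝ^d` as Euclidean space. -/
abbrev Pt (d : ℕ) := EuclideanSpace ℝ (Fin d)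

/-- `L` is an affine line in `ℝ^d`. -/
def IsLine {d : ℕ} (L : Set (Pt d)) : Prop :=
  ∃ a v : Pt d, v ≠ 0 ∧ L = {x | ∃ t : ℝ, x = a + t • v}

/-- A tube of width `w` is the closed `w`-neighborhood of an affine line. -/
def IsTube {d : ℕ} (w : ℝ) (T : Set (Pt d)) : Prop :=
  ∃ L : Set (Pt d), IsLine L ∧ T = Metric.cthickening w L

/-- `A ⊆ ℝ^d` is tube null: for every `δ > 0` it is covered by countably many
tubes `T j` of widths `w j` with `∑ j, (w j)^(d-1) ≤ δ`. -/
def TubeNull (d : ℕ) (A : Set (Pt d)) : Prop :=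
  ∀ δ : ℝ, 0 < δ → ∃ (T : ℕ → Set (Pt d)) (w : ℕ → ℝ),
    (∀ n, 0 < w n ∧ IsTube (w n) (T n)) ∧ (A ⊆ ⋃ n, T n) ∧
    ∑' n, ENNReal.ofReal (w n) ^ (d - 1) ≤ ENNReal.ofReal δ

/-- The Hausdorff measure associated to the gauge function `h`. -/
def gMeasure {d : ℕ} (h : ℝ → ℝ) : Measure (Pt d) :=
  Measure.mkMetric (fun r : ℝ≥0∞ => ENNReal.ofReal (h r.toReal))

/-- `L` is an affine `k`-plane in `ℝ^d`. -/
def IsAffinePlane (d k : ℕ) (L : Set (Pt d)) : Prop :=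
  ∃ V : AffineSubspace ℝ (Pt d), (V : Set (Pt d)).Nonempty ∧
    Module.finrank ℝ V.direction = k ∧ L = (V : Set (Pt d))

/-- A `G(d,k)`-tube of width `w`. -/
def IsGTube (d k : ℕ) (w : ℝ) (T : Set (Pt d)) : Prop :=
  ∃ L : Set (Pt d), IsAffinePlane d k L ∧ T = Metric.cthickening w L

/-- `A` is `G(d,k)`-tube null. -/
def GTubeNull (d k : ℕ) (A : Set (Pt d)) : Prop :=
  ∀ δ : ℝ, 0 < δ → ∃ (T : ℕ → Set (Pt d)) (w : ℕ → ℝ),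
    (∀ n, 0 < w n ∧ IsGTube d k (w n) (T n)) ∧ (A ⊆ ⋃ n, T n) ∧
    ∑' n, ENNReal.ofReal (w n) ^ (d - k) ≤ ENNReal.ofReal δ

/-- The quadratic form `∑ xᵢ² - (∑ xᵢ)² / d`, invariant under translation along `(1, …, 1)`. -/
def shearForm {d : ℕ} (x : Pt d) : ℝ := ∑ i, x i ^ 2 - (∑ i, x i) ^ 2 / d

/-- The quadratic shear in the direction `(1, …, 1)`. -/
def shear {d : ℕ} (σ : ℝ) (x : Pt d) : Pt d := WithLp.toLp 2 fun i => x i + σ * shearForm x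

@[simp] lemma shear_apply {d : ℕ} (σ : ℝ) (x : Pt d) (i : Fin d) :
    shear σ x i = x i + σ * shearForm x := rfl

lemma shearForm_shear {d : ℕ} (hd : 0 < d) (σ : ℝ) (x : Pt d) :
    shearForm (shear σ x) = shearForm x := by
  have hd' : (d : ℝ) ≠ 0 := by positivity
  set s := σ * shearForm x with hs
  have h1 : ∑ i, (x i + s) ^ 2 = ∑ i, x i ^ 2 + 2 * s * ∑ i, x i + d * s ^ 2 := by
    simp only [add_sq, Finset.sum_add_distrib, Finset.sum_const, Finset.card_univ,
      Fintype.card_fin, nsmul_eq_mul, Finset.mul_sum]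
    congr 2
    exact Finset.sum_congr rfl fun i _ => by ring
  have h2 : ∑ i, (x i + s) = ∑ i, x i + d * s := by
    simp [Finset.sum_add_distrib]
  unfold shearForm
  simp only [shear_apply, ← hs]
  rw [h1, h2]
  field_simp
  ring

lemma shear_shear_neg {d : ℕ} (hd : 0 < d) (σ : ℝ) (x : Pt d) : shear σ (shear (-σ) x) = x := by
  ext i
  simp only [shear_apply, shearForm_shear hd]
  ring

/-- The polar form of `shearForm`. -/
def shearPolar {d : ℕ} (x y : Pt d) : ℝ := ∑ i, x i * y i - (∑ i, x i) * (∑ i, y i) / d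

lemma shearForm_add_smul {d : ℕ} (x v : Pt d) (t : ℝ) :
    shearForm (x + t • v) = shearForm x + 2 * t * shearPolar x v + t ^ 2 * shearForm v := by
  have h1 : ∑ i, (x i + t * v i) ^ 2 = ∑ i, x i ^ 2 + 2 * t * ∑ i, x i * v i +
      t ^ 2 * ∑ i, v i ^ 2 := by
    simp only [Finset.mul_sum, ← Finset.sum_add_distrib]
    exact Finset.sum_congr rfl fun i _ => by ring
  have h2 : ∑ i, (x i + t * v i) = ∑ i, x i + t * ∑ i, v i := by
    simp [Finset.mul_sum, ← Finset.sum_add_distrib]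
  unfold shearForm shearPolar
  simp only [PiLp.add_apply, PiLp.smul_apply, smul_eq_mul]
  rw [h1, h2]
  ring

lemma shearForm_nonneg {d : ℕ} (x : Pt d) : 0 ≤ shearForm x := by
  unfold shearForm
  have := sq_sum_le_card_mul_sum_sq (s := Finset.univ) (f := fun i => x i)
  rcases Nat.eq_zero_or_pos d with rfl | hd
  · simp
  have hd' : (0 : ℝ) < d := by positivity
  simp only [Finset.card_univ, Fintype.card_fin] at this
  rw [sub_nonneg, div_le_iff₀ hd']
  linarith

lemma shearForm_le {d : ℕ} (x : Pt d) : shearForm x ≤ ‖x‖ ^ 2 := by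
  rw [EuclideanSpace.real_norm_sq_eq]
  unfold shearForm
  have : 0 ≤ (∑ i, x i) ^ 2 / (d : ℝ) := by positivity
  linarith

lemma shearPolar_sq_le {d : ℕ} (x y : Pt d) :
    shearPolar x y ^ 2 ≤ shearForm x * shearForm y := by
  have h := fun t : ℝ => shearForm_nonneg (y + t • x)
  simp only [shearForm_add_smul] at h
  have := discrim_le_zero (a := shearForm x) (b := 2 * shearPolar y x) (c := shearForm y)
    fun t => by linarith [h t]
  have hc : shearPolar y x = shearPolar x y := by
    unfold shearPolar
    congr 1
    · exact Finset.sum_congr rfl fun i _ => by ring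
    · ring
  unfold discrim at this
  rw [hc] at this
  linarith

lemma abs_shearPolar_le {d : ℕ} (x y : Pt d) : |shearPolar x y| ≤ ‖x‖ * ‖y‖ := by
  apply abs_le_of_sq_le_sq _ (by positivity)
  calc shearPolar x y ^ 2 ≤ shearForm x * shearForm y := shearPolar_sq_le x y
    _ ≤ ‖x‖ ^ 2 * ‖y‖ ^ 2 := by
      gcongr
      · exact shearForm_nonneg y
      · exact shearForm_le x
      · exact shearForm_le y
    _ = _ := by ring

lemma abs_shear_sub_le {d : ℕ} {σ R : ℝ} (hσ : |σ| ≤ 1) {x y : Pt d} (hx : ‖x‖ ≤ R)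
    (hy : ‖y‖ ≤ R) (i : Fin d) :
    |shear σ x i - shear σ y i| ≤ (1 + 4 * R) * ‖x - y‖ := by
  have h := shearForm_add_smul y (x - y) 1
  rw [one_smul, add_sub_cancel] at h
  have h1 := abs_shearPolar_le y (x - y)
  have h2 := shearForm_nonneg (x - y)
  have h3 := shearForm_le (x - y)
  have h4 : |x i - y i| ≤ ‖x - y‖ := by
    simpa using PiLp.norm_apply_le (x - y) i
  have h5 : |shearForm x - shearForm y| ≤ 2 * (‖y‖ * ‖x - y‖) + ‖x - y‖ ^ 2 := by
    rw [h, show shearForm y + 2 * 1 * shearPolar y (x - y) + 1 ^ 2 * shearForm (x - y) - shearForm y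
      = 2 * shearPolar y (x - y) + shearForm (x - y) by ring]
    refine (abs_add_le _ _).trans ?_
    rw [abs_mul, abs_two, abs_of_nonneg h2]
    linarith
  have h6 : ‖x - y‖ ≤ 2 * R := (norm_sub_le x y).trans (by linarith)
  have h7 := norm_nonneg (x - y)
  have h8 : |σ * (shearForm x - shearForm y)| ≤ 4 * R * ‖x - y‖ := by
    rw [abs_mul]
    calc |σ| * |shearForm x - shearForm y| ≤ 1 * |shearForm x - shearForm y| := by gcongr
      _ ≤ 2 * (R * ‖x - y‖) + 2 * R * ‖x - y‖ := by
        rw [one_mul]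
        refine h5.trans ?_
        rw [sq]
        gcongr
      _ = _ := by ring
  calc |shear σ x i - shear σ y i| = |(x i - y i) + σ * (shearForm x - shearForm y)| := by
        simp only [shear_apply]; congr 1; ring
    _ ≤ ‖x - y‖ + 4 * R * ‖x - y‖ := (abs_add_le _ _).trans (add_le_add h4 h8)
    _ = _ := by ring

/-- `shearPolar x` as a linear form. -/
def shearPolarLM {d : ℕ} (x : Pt d) : Pt d →ₗ[ℝ] ℝ where
  toFun v := shearPolar x v
  map_add' v w := by
    simp only [shearPolar, PiLp.add_apply, mul_add, Finset.sum_add_distrib]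
    ring
  map_smul' c v := by
    have h1 : ∑ i, x i * (c * v i) = c * ∑ i, x i * v i := by
      rw [Finset.mul_sum]
      exact Finset.sum_congr rfl fun i _ => by ring
    simp only [shearPolar, PiLp.smul_apply, smul_eq_mul, RingHom.id_apply, h1, ← Finset.mul_sum]
    ring

lemma hasFDerivAt_shearForm {d : ℕ} (x : Pt d) :
    HasFDerivAt shearForm ((2 : ℝ) • (shearPolarLM x).toContinuousLinearMap) x := by
  rw [hasFDerivAt_iff_isLittleO_nhds_zero]
  have : (fun v : Pt d => shearForm (x + v) - shearForm x -
      ((2 : ℝ) • (shearPolarLM x).toContinuousLinearMap) v) = fun v => shearForm v := by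
    funext v
    have := shearForm_add_smul x v 1
    rw [one_smul] at this
    rw [this]
    change _ - _ - 2 * shearPolar x v = _
    ring
  rw [this]
  have h1 : (fun v : Pt d => shearForm v) =O[nhds 0] fun v => ‖v‖ ^ 2 := by
    refine Asymptotics.IsBigO.of_bound 1 (Filter.Eventually.of_forall fun v => ?_)
    rw [Real.norm_of_nonneg (shearForm_nonneg v), Real.norm_of_nonneg (by positivity), one_mul]
    exact shearForm_le v
  exact h1.trans_isLittleO (Asymptotics.isLittleO_norm_pow_id one_lt_two)

lemma shear_eq {d : ℕ} (σ : ℝ) (x : Pt d) :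
    shear σ x = x + shearForm x • (WithLp.toLp 2 fun _ => σ : Pt d) := by
  ext i
  simp [mul_comm]

lemma hasFDerivAt_shear {d : ℕ} (σ : ℝ) (x : Pt d) :
    HasFDerivAt (shear σ) (ContinuousLinearMap.id ℝ (Pt d) +
      ((2 : ℝ) • (shearPolarLM x).toContinuousLinearMap).smulRight
        (WithLp.toLp 2 fun _ => σ : Pt d)) x := by
  have : (shear σ : Pt d → Pt d) =
      fun x => x + shearForm x • (WithLp.toLp 2 fun _ => σ : Pt d) := funext (shear_eq σ)
  rw [this]
  exact (hasFDerivAt_id x).add ((hasFDerivAt_shearForm x).smul_const _)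

lemma continuous_shear {d : ℕ} (σ : ℝ) : Continuous (shear σ : Pt d → Pt d) :=
  continuous_iff_continuousAt.2 fun x => (hasFDerivAt_shear σ x).continuousAt

lemma det_fderiv_shear {d : ℕ} (hd : 0 < d) (σ : ℝ) (x : Pt d) :
    (ContinuousLinearMap.id ℝ (Pt d) +
      ((2 : ℝ) • (shearPolarLM x).toContinuousLinearMap).smulRight
        (WithLp.toLp 2 fun _ => σ : Pt d)).det = 1 := by
  have h1 : ((ContinuousLinearMap.id ℝ (Pt d) +
      ((2 : ℝ) • (shearPolarLM x).toContinuousLinearMap).smulRight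
        (WithLp.toLp 2 fun _ => σ : Pt d) : Pt d →L[ℝ] Pt d) : Pt d →ₗ[ℝ] Pt d) =
      LinearMap.transvection ((2 : ℝ) • shearPolarLM x) (WithLp.toLp 2 fun _ => σ : Pt d) := by
    ext v i
    rfl
  rw [ContinuousLinearMap.det, h1, LinearMap.transvection.det]
  have hd' : (d : ℝ) ≠ 0 := by positivity
  change 1 + 2 * shearPolar x _ = 1
  simp only [shearPolar, ← Finset.sum_mul, Finset.sum_const, Finset.card_univ, Fintype.card_fin,
    nsmul_eq_mul]
  field_simp
  ring

lemma volume_image_shear {d : ℕ} (hd : 0 < d) (σ : ℝ) {s : Set (Pt d)} (hs : MeasurableSet s) :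
    volume (shear σ '' s) = volume s := by
  have hinj : Function.Injective (shear σ : Pt d → Pt d) := by
    refine Function.LeftInverse.injective (g := shear (-σ)) fun x => ?_
    simpa using shear_shear_neg hd (-σ) x
  rw [← lintegral_abs_det_fderiv_eq_addHaar_image volume hs
    (fun x _ => (hasFDerivAt_shear σ x).hasFDerivWithinAt) hinj.injOn]
  simp [det_fderiv_shear hd]

/-- The half-open dyadic cell of generation `n` with index `z`, in sheared coordinates. -/
def cell {d : ℕ} (n : ℕ) (z : Fin d → ℤ) : Set (Pt d) := {x | ∀ i, ⌊2 ^ n * shear 1 x i⌋ = z i}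

/-- The closed dyadic cell of generation `n` with index `z`, in sheared coordinates. -/
def closedCell {d : ℕ} (n : ℕ) (z : Fin d → ℤ) : Set (Pt d) :=
  {x | ∀ i, (z i : ℝ) ≤ 2 ^ n * shear 1 x i ∧ 2 ^ n * shear 1 x i ≤ z i + 1}

lemma continuous_shear_apply {d : ℕ} (σ : ℝ) (i : Fin d) :
    Continuous fun x : Pt d => shear σ x i :=
  (EuclideanSpace.proj (𝕜 := ℝ) i).continuous.comp (continuous_shear σ)

lemma measurableSet_cell {d : ℕ} (n : ℕ) (z : Fin d → ℤ) : MeasurableSet (cell n z) := by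
  have : cell n z = ⋂ i, (fun x : Pt d => ⌊2 ^ n * shear 1 x i⌋) ⁻¹' {z i} := by
    ext x; simp [cell]
  rw [this]
  refine MeasurableSet.iInter fun i => ?_
  have : Measurable fun x : Pt d => ⌊2 ^ n * shear 1 x i⌋ :=
    Int.measurable_floor.comp ((continuous_shear_apply 1 i).measurable.const_mul _)
  exact this (measurableSet_singleton _)

lemma isClosed_closedCell {d : ℕ} (n : ℕ) (z : Fin d → ℤ) : IsClosed (closedCell n z) := by
  have : closedCell n z = ⋂ i, {x : Pt d | (z i : ℝ) ≤ 2 ^ n * shear 1 x i} ∩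
      {x : Pt d | 2 ^ n * shear 1 x i ≤ z i + 1} := by
    ext x; simp [closedCell]
  rw [this]
  refine isClosed_iInter fun i => IsClosed.inter ?_ ?_
  · exact isClosed_le continuous_const (continuous_const.mul (continuous_shear_apply 1 i))
  · exact isClosed_le (continuous_const.mul (continuous_shear_apply 1 i)) continuous_const

lemma cell_subset_closedCell {d : ℕ} (n : ℕ) (z : Fin d → ℤ) : cell n z ⊆ closedCell n z := by
  intro x hx i
  rw [← hx i]
  exact ⟨Int.floor_le _, (Int.lt_floor_add_one _).le⟩

lemma volume_cell {d : ℕ} (hd : 0 < d) (n : ℕ) (z : Fin d → ℤ) :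
    volume.real (cell n z) = ((2 : ℝ) ^ (n * d))⁻¹ := by
  have h2 : (0 : ℝ) < 2 ^ n := by positivity
  set Q : Set (Fin d → ℝ) := univ.pi fun i => Ico ((z i : ℝ) / 2 ^ n) ((z i + 1) / 2 ^ n) with hQ
  have hQm : MeasurableSet Q := MeasurableSet.univ_pi fun _ => measurableSet_Ico
  have hcell : cell n z = shear (-1) '' (WithLp.ofLp ⁻¹' Q : Set (Pt d)) := by
    have key : ∀ u : Pt d, u ∈ (WithLp.ofLp ⁻¹' Q : Set (Pt d)) ↔ ∀ i, ⌊2 ^ n * u i⌋ = z i := by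
      intro u
      simp only [hQ, mem_preimage, mem_univ_pi, mem_Ico, Int.floor_eq_iff]
      refine forall_congr' fun i => ?_
      rw [div_le_iff₀ h2, lt_div_iff₀ h2, mul_comm (2 ^ n : ℝ)]
    ext x
    constructor
    · intro hx
      refine ⟨shear 1 x, (key _).2 hx, by simpa using shear_shear_neg hd (-1) x⟩
    · rintro ⟨u, hu, rfl⟩ i
      rw [shear_shear_neg hd]
      exact (key u).1 hu i
  rw [measureReal_def, hcell, volume_image_shear hd]
  · rw [(PiLp.volume_preserving_ofLp (Fin d)).measure_preimage hQm.nullMeasurableSet, hQ,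
      Real.volume_pi_Ico_toReal]
    · have : ∀ i, ((z i : ℝ) + 1) / 2 ^ n - z i / 2 ^ n = (2 ^ n)⁻¹ := fun i => by
        field_simp; ring
      simp [this, pow_mul]
    · intro i
      simp only
      gcongr
      linarith
  · exact (PiLp.volume_preserving_ofLp (Fin d)).measurable hQm

lemma EuclideanSpace.norm_le_card_mul {d : ℕ} {x : Pt d} {c : ℝ} (hc : 0 ≤ c)
    (h : ∀ i, |x i| ≤ c) : ‖x‖ ≤ d * c := by
  refine abs_le_of_sq_le_sq' ?_ (by positivity) |>.2
  rw [EuclideanSpace.real_norm_sq_eq]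
  calc ∑ i, x i ^ 2 ≤ ∑ _i : Fin d, c ^ 2 := by
        refine Finset.sum_le_sum fun i _ => ?_
        rw [← sq_abs]
        gcongr
        exact h i
    _ = d * c ^ 2 := by simp
    _ ≤ (d * c) ^ 2 := by
      rw [mul_pow]
      gcongr
      exact_mod_cast Nat.le_self_pow two_ne_zero d

/-- A bound for the norm of points of cells inside the unit cube, and for the diameters of cells
relative to their side length. -/
def cellRadius (d : ℕ) : ℝ := d * ((1 + 4 * d) * d)

lemma cellRadius_nonneg (d : ℕ) : 0 ≤ cellRadius d := by unfold cellRadius; positivity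

lemma one_le_cellRadius {d : ℕ} (hd : 0 < d) : 1 ≤ cellRadius d := by
  have : (1 : ℝ) ≤ d := by exact_mod_cast hd
  unfold cellRadius
  nlinarith [mul_le_mul this this (by norm_num) (by positivity)]

lemma norm_sub_le_of_abs_shear_sub_le {d : ℕ} (hd : 0 < d) {x y : Pt d} {δ : ℝ} (hδ : 0 ≤ δ)
    (hx : ‖shear 1 x‖ ≤ d) (hy : ‖shear 1 y‖ ≤ d)
    (h : ∀ i, |shear 1 x i - shear 1 y i| ≤ δ) : ‖x - y‖ ≤ cellRadius d * δ := by
  have h1 : ‖shear 1 x - shear 1 y‖ ≤ d * δ := EuclideanSpace.norm_le_card_mul hδ h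
  have h2 : ∀ i, |(x - y) i| ≤ (1 + 4 * d) * (d * δ) := by
    intro i
    have := abs_shear_sub_le (σ := -1) (by simp) hx hy i
    have e : ∀ x : Pt d, shear (-1) (shear 1 x) = x := fun x => by
      simpa using shear_shear_neg hd (-1) x
    rw [e, e] at this
    exact this.trans (by gcongr)
  have := EuclideanSpace.norm_le_card_mul (by positivity) h2
  unfold cellRadius
  linarith

/-- The indices of the generation `n` cells in the unit cube. -/
def IsUnitIndex {d : ℕ} (n : ℕ) (z : Fin d → ℤ) : Prop := ∀ i, 0 ≤ z i ∧ z i < 2 ^ n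

lemma shear_mem_unit {d : ℕ} {n : ℕ} {z : Fin d → ℤ} (hz : IsUnitIndex n z) {x : Pt d}
    (hx : x ∈ closedCell n z) (i : Fin d) : 0 ≤ shear 1 x i ∧ shear 1 x i ≤ 1 := by
  have h2 : (0 : ℝ) < 2 ^ n := by positivity
  obtain ⟨h0, h1⟩ := hz i
  obtain ⟨h3, h4⟩ := hx i
  have h0' : (0 : ℝ) ≤ z i := by exact_mod_cast h0
  have h1' : (z i : ℝ) + 1 ≤ 2 ^ n := by exact_mod_cast h1
  constructor
  · exact nonneg_of_mul_nonneg_right (h0'.trans h3) h2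
  · exact le_of_mul_le_mul_left (by linarith) h2

lemma norm_shear_le {d : ℕ} {n : ℕ} {z : Fin d → ℤ} (hz : IsUnitIndex n z) {x : Pt d}
    (hx : x ∈ closedCell n z) : ‖shear 1 x‖ ≤ d := by
  have : ∀ i, |shear 1 x i| ≤ 1 := fun i => by
    obtain ⟨h1, h2⟩ := shear_mem_unit hz hx i
    rw [abs_of_nonneg h1]; exact h2
  simpa using EuclideanSpace.norm_le_card_mul zero_le_one this

lemma norm_le_cellRadius {d : ℕ} (hd : 0 < d) {n : ℕ} {z : Fin d → ℤ} (hz : IsUnitIndex n z)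
    {x : Pt d} (hx : x ∈ closedCell n z) : ‖x‖ ≤ cellRadius d := by
  have h0 : shear 1 (0 : Pt d) = 0 := by ext i; simp [shearForm]
  have := norm_sub_le_of_abs_shear_sub_le hd zero_le_one (norm_shear_le hz hx) (y := 0)
    (by rw [h0]; simp) fun i => by
      obtain ⟨h1, h2⟩ := shear_mem_unit hz hx i
      rw [h0]
      simpa [abs_of_nonneg h1, -shear_apply] using h2
  simpa using this

lemma norm_sub_le_of_mem_closedCell {d : ℕ} (hd : 0 < d) {n : ℕ} {z : Fin d → ℤ}
    (hz : IsUnitIndex n z) {x y : Pt d} (hx : x ∈ closedCell n z) (hy : y ∈ closedCell n z) :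
    ‖x - y‖ ≤ cellRadius d * (2 ^ n)⁻¹ := by
  refine norm_sub_le_of_abs_shear_sub_le hd (by positivity) (norm_shear_le hz hx)
    (norm_shear_le hz hy) fun i => ?_
  have h2 : (0 : ℝ) < 2 ^ n := by positivity
  have := hx i
  have := hy i
  rw [← one_div, le_div_iff₀ h2]
  have h3 : |shear 1 x i - shear 1 y i| * 2 ^ n = |(shear 1 x i - shear 1 y i) * 2 ^ n| := by
    rw [abs_mul, abs_of_pos h2]
  rw [h3, abs_le]
  constructor <;> linarith

/-- The set of points whose coordinates along the vectors `E j` are within `w` of `p j`. -/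
def slab {d m : ℕ} (E : Fin m → Pt d) (p : Fin m → ℝ) (w : ℝ) : Set (Pt d) :=
  {x | ∀ j, |inner ℝ (E j) x - p j| ≤ w}

lemma isClosed_slab {d m : ℕ} (E : Fin m → Pt d) (p : Fin m → ℝ) (w : ℝ) :
    IsClosed (slab E p w) := by
  simp only [slab, ofPred_forall]
  exact isClosed_iInter fun j => isClosed_le (by fun_prop) continuous_const

lemma Orthonormal.exists_basis_sum {d m k : ℕ} (hdmk : d = m + k) {E : Fin m → Pt d}
    (hE : Orthonormal ℝ E) :
    ∃ b : OrthonormalBasis (Fin m ⊕ Fin k) ℝ (Pt d), ∀ j, b (Sum.inl j) = E j := by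
  have hr : Orthonormal ℝ ((range (Sum.inl : Fin m → Fin m ⊕ Fin k)).domRestrict
      (Sum.elim E (fun _ => 0))) := by
    rw [orthonormal_iff_ite] at hE ⊢
    rintro ⟨_, i, rfl⟩ ⟨_, j, rfl⟩
    simpa [Subtype.ext_iff] using hE i j
  obtain ⟨b, hb⟩ := hr.exists_orthonormalBasis_extension_of_card_eq (by simp [hdmk])
  exact ⟨b, fun j => by simpa using hb (Sum.inl j) ⟨j, rfl⟩⟩

section box

variable {d : ℕ} {ι : Type*} [Fintype ι]

lemma OrthonormalBasis.measurePreserving_coord (b : OrthonormalBasis ι ℝ (Pt d)) :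
    MeasurePreserving (fun (x : Pt d) i => inner ℝ (b i) x) := by
  have h : (fun (x : Pt d) i => inner ℝ (b i) x) = WithLp.ofLp ∘ b.repr := by
    funext x i
    simp [b.repr_apply_apply]
  rw [h]
  exact (PiLp.volume_preserving_ofLp ι).comp b.measurePreserving_repr

lemma volume_le_of_subset_box (b : OrthonormalBasis ι ℝ (Pt d)) {c r : ι → ℝ} (hr : ∀ i, 0 ≤ r i)
    {G : Set (Pt d)} (hG : ∀ x ∈ G, ∀ i, |inner ℝ (b i) x - c i| ≤ r i) :
    volume G ≤ ENNReal.ofReal (∏ i, 2 * r i) := by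
  have h1 : G ⊆ (fun (x : Pt d) i => inner ℝ (b i) x) ⁻¹' (Icc (fun i => c i - r i)
      (fun i => c i + r i)) := by
    intro x hx
    simp only [mem_preimage, mem_Icc, Pi.le_def]
    refine ⟨fun i => ?_, fun i => ?_⟩ <;> have := abs_le.1 (hG x hx i) <;> linarith
  refine (measure_mono h1).trans ?_
  rw [b.measurePreserving_coord.measure_preimage measurableSet_Icc.nullMeasurableSet,
    Real.volume_Icc_pi, ENNReal.ofReal_prod_of_nonneg (fun i _ => by linarith [hr i])]
  refine le_of_eq (Finset.prod_congr rfl fun i _ => ?_)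
  congr 1
  ring

lemma volume_le_of_sections [DecidableEq ι] (b : OrthonormalBasis ι ℝ (Pt d)) (i₀ : ι)
    {c r : ι → ℝ} (hr : ∀ i, 0 ≤ r i) {G : Set (Pt d)} (hGm : MeasurableSet G)
    (hG : ∀ x ∈ G, ∀ i, i ≠ i₀ → |inner ℝ (b i) x - c i| ≤ r i) {ℓ : ℝ} (hℓ : 0 ≤ ℓ)
    (hsec : ∀ x : Pt d, volume {t : ℝ | x + t • b i₀ ∈ G} ≤ ENNReal.ofReal ℓ) :
    volume G ≤ ENNReal.ofReal (ℓ * ∏ i ∈ Finset.univ.erase i₀, 2 * r i) := by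
  classical
  set g : (ι → ℝ) → Pt d := fun y => ∑ i, y i • b i with hg
  have hgc : Continuous g := by fun_prop
  have hgf : ∀ x : Pt d, g (fun i => inner ℝ (b i) x) = x := fun x => b.sum_repr' x
  have hfg : ∀ y i, inner ℝ (b i) (g y) = y i := fun y i => by
    simp only [hg]
    exact b.orthonormal.inner_right_fintype y i
  set e := MeasurableEquiv.piEquivPiSubtypeProd (fun _ : ι => ℝ) (fun i => i ≠ i₀) with he
  have hemp := volume_preserving_piEquivPiSubtypeProd (fun _ : ι => ℝ) (fun i => i ≠ i₀)
  set H := g ∘ e.symm with hH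
  have hHm : Measurable H := hgc.measurable.comp e.symm.measurable
  have h1 : volume G = volume (H ⁻¹' G) := by
    have h2 : G = (fun (x : Pt d) i => inner ℝ (b i) x) ⁻¹' (e ⁻¹' (H ⁻¹' G)) := by
      ext x
      simp [hH, hgf]
    conv_lhs => rw [h2]
    rw [b.measurePreserving_coord.measure_preimage
      (e.measurable (hHm hGm)).nullMeasurableSet, hemp.measure_preimage
      (hHm hGm).nullMeasurableSet]
  have : Unique {i // ¬ i ≠ i₀} :=
    { default := ⟨i₀, by simp⟩, uniq := fun a => Subtype.ext (not_not.1 a.2) }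
  have hsplit : ∀ (s : {i // i ≠ i₀} → ℝ) (t : {i // ¬ i ≠ i₀} → ℝ),
      H (s, t) = H (s, 0) + t default • b i₀ := by
    intro s t
    have hval : ∀ t i, e.symm (s, t) i = if h : i ≠ i₀ then s ⟨i, h⟩ else t ⟨i, h⟩ := fun _ _ => rfl
    simp only [hH, Function.comp, hg, hval]
    rw [← Finset.add_sum_erase _ _ (Finset.mem_univ i₀),
      ← Finset.add_sum_erase _ (fun i => _ • b i) (Finset.mem_univ i₀)]
    have hs : ∀ t : {i // ¬ i ≠ i₀} → ℝ, ∑ i ∈ Finset.univ.erase i₀,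
        (if h : i ≠ i₀ then s ⟨i, h⟩ else t ⟨i, h⟩) • b i =
        ∑ i ∈ (Finset.univ.erase i₀).attach, s ⟨i.1, (Finset.mem_erase.1 i.2).1⟩ • b i.1 := by
      intro t
      rw [← Finset.sum_attach]
      refine Finset.sum_congr rfl fun i _ => ?_
      rw [dif_pos (Finset.mem_erase.1 i.2).1]
    rw [hs, hs]
    simp only [ne_eq, not_true_eq_false, dite_false, Pi.zero_apply, zero_smul, zero_add]
    rw [add_comm, Unique.eq_default (⟨i₀, not_not.2 rfl⟩ : {i // ¬ i ≠ i₀})]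
  have hinner : ∀ (s : {i // i ≠ i₀} → ℝ) (t : {i // ¬ i ≠ i₀} → ℝ) (i : {i // i ≠ i₀}),
      inner ℝ (b i.1) (H (s, t)) = s i := by
    intro s t i
    simp only [hH, Function.comp, hfg]
    change (if h : i.1 ≠ i₀ then s ⟨i.1, h⟩ else t ⟨i.1, h⟩) = _
    rw [dif_pos i.2]
  set B : Set ({i // i ≠ i₀} → ℝ) := Icc (fun i => c i - r i) (fun i => c i + r i) with hB
  rw [h1, Measure.volume_eq_prod, Measure.prod_apply (hHm hGm)]
  calc ∫⁻ s, volume (Prod.mk s ⁻¹' (H ⁻¹' G)) ≤ ∫⁻ s, B.indicator (fun _ => ENNReal.ofReal ℓ) s := by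
        refine lintegral_mono fun s => ?_
        by_cases hs : s ∈ B
        · rw [indicator_of_mem hs]
          have : Prod.mk s ⁻¹' (H ⁻¹' G) =
              MeasurableEquiv.funUnique {i // ¬ i ≠ i₀} ℝ ⁻¹' {t : ℝ | H (s, 0) + t • b i₀ ∈ G} := by
            ext t
            simp only [mem_preimage, mem_ofPred_eq]
            rw [hsplit]
            rfl
          rw [this]
          refine le_trans (le_of_eq ?_) (hsec (H (s, 0)))
          convert (volume_preserving_funUnique {i // ¬ i ≠ i₀} ℝ).measure_preimage_equiv
            {t : ℝ | H (s, 0) + t • b i₀ ∈ G}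
        · rw [indicator_of_notMem hs, nonpos_iff_eq_zero]
          convert measure_empty (μ := volume)
          refine eq_empty_of_forall_notMem fun t ht => hs ?_
          have := fun i : {i // i ≠ i₀} => hG _ ht i.1 i.2
          simp only [hinner] at this
          simp only [hB, mem_Icc, Pi.le_def]
          refine ⟨fun i => ?_, fun i => ?_⟩ <;> have := abs_le.1 (this i) <;> linarith
    _ = ENNReal.ofReal ℓ * volume B := by
        rw [lintegral_indicator measurableSet_Icc, setLIntegral_const]
    _ = ENNReal.ofReal (ℓ * ∏ i ∈ Finset.univ.erase i₀, 2 * r i) := by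
        rw [ENNReal.ofReal_mul hℓ, hB, Real.volume_Icc_pi,
          ENNReal.ofReal_prod_of_nonneg (fun i _ => by linarith [hr i])]
        congr 1
        rw [Finset.prod_subtype (p := fun i => i ≠ i₀) _ (by simp)]
        refine Finset.prod_congr rfl fun i _ => ?_
        congr 1
        ring

end box

lemma volume_quadratic_le {α β γ s τ : ℝ} (hτ : 0 < τ) (hα : τ ^ 2 ≤ α) (hs : 0 ≤ s) :
    volume {t : ℝ | |α * t ^ 2 + β * t + γ| ≤ s} ≤ ENNReal.ofReal (4 * √s / τ) := by
  have hα0 : 0 < α := lt_of_lt_of_le (by positivity) hα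
  set b := β / (2 * α) with hb
  set c := (γ - β ^ 2 / (4 * α)) / α with hc
  set B := -c + s / α with hB
  set A := -c - s / α with hA
  have hkey : ∀ t, α * t ^ 2 + β * t + γ = α * ((t + b) ^ 2 + c) := by
    intro t
    rw [hb, hc]
    field_simp
    ring
  have hsub : {t : ℝ | |α * t ^ 2 + β * t + γ| ≤ s} ⊆
      Icc (-b - √B) (-b - √A) ∪ Icc (-b + √A) (-b + √B) := by
    intro t ht
    simp only [mem_ofPred_eq, hkey, abs_mul, abs_of_pos hα0] at ht
    rw [mul_comm, ← le_div_iff₀ hα0, abs_le] at ht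
    have h1 : |t + b| ≤ √B := Real.abs_le_sqrt (by rw [hB]; linarith)
    have h2 : √A ≤ |t + b| := Real.sqrt_le_iff.2 ⟨abs_nonneg _, by rw [sq_abs, hA]; linarith⟩
    rcases abs_cases (t + b) with ⟨h, _⟩ | ⟨h, _⟩ <;> rw [h] at h1 h2
    · right; constructor <;> linarith
    · left; constructor <;> linarith
  have hlen : √B - √A ≤ 2 * √s / τ := by
    have h1 : √B ≤ √A + 2 * √s / τ := by
      rw [Real.sqrt_le_iff]
      refine ⟨by positivity, ?_⟩
      have h2 : A ≤ √A ^ 2 := by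
        by_cases h : 0 ≤ A
        · rw [Real.sq_sqrt h]
        · exact (not_le.1 h).le.trans (sq_nonneg _)
      have h3 : B - A ≤ (2 * √s / τ) ^ 2 := by
        rw [div_pow, mul_pow, Real.sq_sqrt hs]
        have h4 : s / α ≤ s / τ ^ 2 := by gcongr
        have h5 : 0 ≤ s / τ ^ 2 := by positivity
        rw [hB, hA, mul_div_assoc]
        linarith
      have h4 : 0 ≤ √A * (2 * √s / τ) := by positivity
      nlinarith
    linarith
  refine (measure_mono hsub).trans ((measure_union_le _ _).trans ?_)
  rw [Real.volume_Icc, Real.volume_Icc]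
  calc _ ≤ ENNReal.ofReal (2 * √s / τ) + ENNReal.ofReal (2 * √s / τ) := by
        gcongr <;> linarith
    _ = _ := by
        rw [← ENNReal.ofReal_add (by positivity) (by positivity)]
        congr 1
        ring

lemma shearPolar_single_sub {d : ℕ} (v : Pt d) (i j : Fin d) :
    shearPolar v (EuclideanSpace.single i 1 - EuclideanSpace.single j 1) = v i - v j := by
  simp [shearPolar, mul_sub, Finset.sum_sub_distrib]

lemma abs_sub_le_of_shearForm_le {d : ℕ} {v : Pt d} {τ : ℝ} (hτ : 0 ≤ τ)
    (hv : shearForm v ≤ τ ^ 2) (i j : Fin d) : |v i - v j| ≤ 2 * τ := by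
  rw [← shearPolar_single_sub]
  set w : Pt d := EuclideanSpace.single i 1 - EuclideanSpace.single j 1 with hw
  have hw2 : ‖w‖ ≤ 2 := (norm_sub_le _ _).trans (by norm_num)
  have hw4 : shearForm w ≤ 2 ^ 2 := (shearForm_le w).trans (by gcongr)
  apply abs_le_of_sq_le_sq _ (by positivity)
  calc shearPolar v w ^ 2 ≤ shearForm v * shearForm w := shearPolar_sq_le v w
    _ ≤ τ ^ 2 * 2 ^ 2 := by gcongr; exact shearForm_nonneg w
    _ = _ := by ring

/-- Lines meet thin neighbourhoods of sheared coordinate hyperplanes in short sets. -/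
lemma volume_face_section_le {d : ℕ} (hd : 0 < d) {R : ℝ} (hR : 0 ≤ R) :
    ∃ C : ℝ, 0 ≤ C ∧ ∀ v : Pt d, ‖v‖ = 1 → ∀ (i : Fin d) (a s : ℝ), 0 ≤ s → s ≤ 1 → ∀ x : Pt d,
      volume {t : ℝ | ‖x + t • v‖ ≤ R ∧ |shear 1 (x + t • v) i - a| ≤ s} ≤
        ENNReal.ofReal (C * √s) := by
  have hd' : (0 : ℝ) < d := by positivity
  set τ : ℝ := 1 / (8 * d * (R + 1)) with hτdef
  have hτ : 0 < τ := by positivity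
  refine ⟨4 / τ + 4 * d, by positivity, fun v hv i a s hs hs1 x => ?_⟩
  by_cases hcase : τ ^ 2 ≤ shearForm v
  · calc _ ≤ volume {t : ℝ | |shearForm v * t ^ 2 + (v i + 2 * shearPolar x v) * t +
            (x i + shearForm x - a)| ≤ s} := by
          refine measure_mono fun t ht => ?_
          have := ht.2
          simp only [shear_apply, shearForm_add_smul, PiLp.add_apply, PiLp.smul_apply,
            smul_eq_mul] at this
          simp only [mem_ofPred_eq]
          convert this using 2
          ring
      _ ≤ ENNReal.ofReal (4 * √s / τ) := volume_quadratic_le hτ hcase hs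
      _ ≤ _ := by
          apply ENNReal.ofReal_le_ofReal
          have : 0 ≤ 4 * d * √s := by positivity
          rw [add_mul, div_mul_eq_mul_div]
          linarith
  · replace hcase := (not_le.1 hcase).le
    refine (Real.volume_le_diam _).trans (Metric.ediam_le fun t ht t' ht' => ?_)
    rw [edist_dist]
    apply ENNReal.ofReal_le_ofReal
    rw [Real.dist_eq, abs_sub_comm]
    have hs2 : s ≤ √s := Real.le_sqrt_of_sq_le (by nlinarith)
    set y := x + t • v with hy
    set r := t' - t with hr
    have hy' : x + t' • v = y + r • v := by rw [hy, hr, sub_smul]; abel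
    simp only [mem_ofPred_eq, ← hy, hy'] at ht ht'
    obtain ⟨h1, h2⟩ := ht
    obtain ⟨h3, h4⟩ := ht'
    have hr2 : |r| ≤ 2 * R := by
      have : ‖r • v‖ ≤ 2 * R := by
        rw [show r • v = (y + r • v) - y by abel]
        exact (norm_sub_le _ _).trans (by linarith)
      simpa [norm_smul, hv] using this
    have hB : |shearPolar y v| ≤ R * τ := by
      apply abs_le_of_sq_le_sq _ (by positivity)
      calc shearPolar y v ^ 2 ≤ shearForm y * shearForm v := shearPolar_sq_le y v
        _ ≤ R ^ 2 * τ ^ 2 := by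
          gcongr
          · exact shearForm_nonneg v
          · exact (shearForm_le y).trans (by gcongr)
        _ = _ := by ring
    have hvi : 1 / d - 2 * τ ≤ |v i| := by
      have h5 : ‖v‖ ≤ d * (|v i| + 2 * τ) := EuclideanSpace.norm_le_card_mul (by positivity)
        fun j => by
          have := abs_sub_le_of_shearForm_le hτ.le hcase j i
          have := abs_sub_abs_le_abs_sub (v j) (v i)
          linarith
      rw [hv] at h5
      have : 1 / (d : ℝ) ≤ |v i| + 2 * τ := by
        rw [div_le_iff₀ hd']; linarith
      linarith
    have hq : |r| * shearForm v ≤ 2 * R * τ := by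
      have hτ1 : τ ≤ 1 := by
        rw [hτdef, div_le_one (by positivity)]
        have : (1 : ℝ) ≤ d := by exact_mod_cast hd
        nlinarith
      calc |r| * shearForm v ≤ (2 * R) * τ ^ 2 := by gcongr; exact shearForm_nonneg v
        _ ≤ (2 * R) * τ := by gcongr; nlinarith
    have hcoef : 1 / (2 * d) ≤ |v i| - 2 * |shearPolar y v| - |r| * shearForm v := by
      have h6 : 4 * (R + 1) * τ = 1 / (2 * d) := by
        rw [hτdef]; field_simp; norm_num
      have h7 : (1 : ℝ) / d = 1 / (2 * d) + 1 / (2 * d) := by field_simp; norm_num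
      nlinarith
    have hdiff : r * (v i + 2 * shearPolar y v + r * shearForm v) =
        (shear 1 (y + r • v) i - a) - (shear 1 y i - a) := by
      simp only [shear_apply, shearForm_add_smul, PiLp.add_apply, PiLp.smul_apply, smul_eq_mul]
      ring
    have h8 : |r| * |v i + 2 * shearPolar y v + r * shearForm v| ≤ 2 * s := by
      rw [← abs_mul, hdiff]
      exact (abs_sub _ _).trans (by linarith)
    have h9 : |v i| - 2 * |shearPolar y v| - |r| * shearForm v ≤
        |v i + 2 * shearPolar y v + r * shearForm v| := by
      have e1 : |r * shearForm v| = |r| * shearForm v := by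
        rw [abs_mul, abs_of_nonneg (shearForm_nonneg v)]
      have e2 : |2 * shearPolar y v| = 2 * |shearPolar y v| := by rw [abs_mul]; norm_num
      have e3 := abs_sub_abs_le_abs_sub (v i) (-(2 * shearPolar y v + r * shearForm v))
      have e4 := abs_add_le (2 * shearPolar y v) (r * shearForm v)
      rw [abs_neg, sub_neg_eq_add, ← add_assoc] at e3
      linarith
    have h10 : |r| * (1 / (2 * d)) ≤ 2 * s :=
      (mul_le_mul_of_nonneg_left (hcoef.trans h9) (abs_nonneg _)).trans h8
    have h11 : |r| ≤ 4 * d * s := by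
      rw [mul_one_div, div_le_iff₀ (by positivity)] at h10
      linarith
    have h12 : 4 * d * s ≤ 4 * d * √s := by gcongr
    have : 0 ≤ 4 / τ * √s := by positivity
    linarith

/-- The part of a slab near a sheared coordinate hyperplane has small volume. -/
lemma volume_face_le {d m k : ℕ} (hdmk : d = m + k) (hk : 1 ≤ k) {R : ℝ} (hR : 0 < R) :
    ∃ C : ℝ, 0 ≤ C ∧ ∀ (E : Fin m → Pt d), Orthonormal ℝ E → ∀ (p : Fin m → ℝ) (w : ℝ), 0 ≤ w →
      ∀ (i : Fin d) (a s : ℝ), 0 ≤ s → s ≤ 1 →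
        volume ({x | ‖x‖ ≤ R ∧ |shear 1 x i - a| ≤ s} ∩ slab E p w) ≤
          ENNReal.ofReal (C * w ^ m * √s) := by
  obtain ⟨C₀, hC₀, hsec⟩ := volume_face_section_le (d := d) (by omega) hR.le
  refine ⟨C₀ * (2 ^ m * (2 * R) ^ k / (2 * R)), by positivity,
    fun E hE p w hw i a s hs hs1 => ?_⟩
  obtain ⟨b, hb⟩ := hE.exists_basis_sum hdmk
  set i₀ : Fin m ⊕ Fin k := Sum.inr ⟨0, hk⟩ with hi₀
  have hclosed : IsClosed ({x : Pt d | ‖x‖ ≤ R ∧ |shear 1 x i - a| ≤ s} ∩ slab E p w) := by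
    refine IsClosed.inter ?_ (isClosed_slab E p w)
    have h1 : IsClosed {x : Pt d | |shear 1 x i - a| ≤ s} :=
      isClosed_le ((continuous_shear_apply 1 i).sub continuous_const).abs continuous_const
    exact (isClosed_le continuous_norm continuous_const).inter h1
  have hr : ∀ i : Fin m ⊕ Fin k, 0 ≤ Sum.elim (fun _ : Fin m => w) (fun _ : Fin k => R) i := by
    rintro (_ | _) <;> simp [hw, hR.le]
  refine (volume_le_of_sections b i₀ (c := Sum.elim p 0) hr hclosed.measurableSet ?_
    (ℓ := C₀ * √s) (by positivity) fun x => ?_).trans ?_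
  · rintro x ⟨⟨hx, -⟩, hx'⟩ (j | j) -
    · simpa [hb] using hx' j
    · simpa using (abs_real_inner_le_norm (b (Sum.inr j)) x).trans (by simpa using hx)
  · refine (measure_mono fun t ht => ?_).trans (hsec (b i₀) (b.orthonormal.1 i₀) i a s hs hs1 x)
    exact ht.1
  · apply ENNReal.ofReal_le_ofReal
    have h1 := Finset.mul_prod_erase Finset.univ
      (fun i => 2 * Sum.elim (fun _ : Fin m => w) (fun _ : Fin k => R) i) (Finset.mem_univ i₀)
    simp only [Fintype.prod_sum_type, Sum.elim_inl, Sum.elim_inr, Finset.prod_const,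
      Finset.card_univ, Fintype.card_fin, hi₀] at h1
    have h2 : ∏ i ∈ Finset.univ.erase i₀, 2 * Sum.elim (fun _ : Fin m => w) (fun _ : Fin k => R) i =
        (2 * w) ^ m * (2 * R) ^ k / (2 * R) := by
      rw [eq_div_iff (by positivity), ← h1, mul_comm]
    rw [h2, mul_pow 2 w]
    apply le_of_eq
    ring

/-- The union of the generation `n` cells with indices in `S`. -/
def cellUnion {d : ℕ} (n : ℕ) (S : Finset (Fin d → ℤ)) : Set (Pt d) := ⋃ z ∈ S, cell n z

lemma measurableSet_cellUnion {d : ℕ} (n : ℕ) (S : Finset (Fin d → ℤ)) :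
    MeasurableSet (cellUnion n S) :=
  Finset.measurableSet_biUnion _ fun z _ => measurableSet_cell n z

lemma pairwiseDisjoint_cell {d : ℕ} (n : ℕ) (S : Set (Fin d → ℤ)) :
    S.PairwiseDisjoint (cell n) := by
  intro z _ z' _ hne
  refine Set.disjoint_left.2 fun x hx hx' => hne ?_
  funext i
  rw [← hx i, hx' i]

lemma volume_cellUnion_inter {d : ℕ} (n : ℕ) (S : Finset (Fin d → ℤ)) {T : Set (Pt d)}
    (hT : MeasurableSet T) :
    volume (cellUnion n S ∩ T) = ∑ z ∈ S, volume (cell n z ∩ T) := by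
  rw [cellUnion, iUnion₂_inter, measure_biUnion_finset]
  · exact fun z hz z' hz' hne => (pairwiseDisjoint_cell n S hz hz' hne).mono
      inter_subset_left inter_subset_left
  · exact fun z _ => (measurableSet_cell n z).inter hT

lemma volume_inter_slab_le {d m k : ℕ} (hdmk : d = m + k) {E : Fin m → Pt d}
    (hE : Orthonormal ℝ E) (p : Fin m → ℝ) {w r : ℝ} (hw : 0 ≤ w) (hr : 0 ≤ r) {G : Set (Pt d)}
    {x₀ : Pt d} (hG : ∀ x ∈ G, ‖x - x₀‖ ≤ r) :
    volume (G ∩ slab E p w) ≤ ENNReal.ofReal ((2 * w) ^ m * (2 * r) ^ k) := by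
  obtain ⟨b, hb⟩ := hE.exists_basis_sum hdmk
  refine (volume_le_of_subset_box b (c := Sum.elim p fun j => inner ℝ (b (Sum.inr j)) x₀)
    (r := Sum.elim (fun _ => w) fun _ => r) ?_ ?_).trans (le_of_eq ?_)
  · rintro (_ | _) <;> simp [hw, hr]
  · rintro x ⟨hx, hx'⟩ (j | j)
    · simpa [hb] using hx' j
    · rw [Sum.elim_inr, Sum.elim_inr, ← inner_sub_right]
      simpa using (abs_real_inner_le_norm (b (Sum.inr j)) (x - x₀)).trans (by simpa using hG x hx)
  · simp

lemma mul_volume_inter_slab_le {d m : ℕ} {E : Fin m → Pt d} {p : Fin m → ℝ} {w ρ : ℝ}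
    (hw : 0 ≤ w) (hρ : 0 ≤ ρ) {U : Set (Pt d)} (hU : MeasurableSet U) {c : ℝ≥0∞}
    (hc : ∀ y : Fin m → ℝ, (∀ j, |y j| ≤ ρ) → c ≤ volume (U ∩ slab E (p + y) w)) :
    c * ENNReal.ofReal ((2 * ρ) ^ m) ≤
      ENNReal.ofReal ((2 * w) ^ m) * volume (U ∩ slab E p (ρ + w)) := by
  set I : Set (Fin m → ℝ) := Icc (fun _ => -ρ) (fun _ => ρ) with hI
  have hIm : ∀ y, y ∈ I ↔ ∀ j, |y j| ≤ ρ := fun y => by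
    simp only [hI, mem_Icc, Pi.le_def, abs_le, forall_and]
  set Q : Set ((Fin m → ℝ) × Pt d) :=
    {q | q.1 ∈ I ∧ q.2 ∈ U ∧ ∀ j, |inner ℝ (E j) q.2 - (p + q.1) j| ≤ w} with hQ
  have hQm : MeasurableSet Q := by
    have h1 : MeasurableSet {q : (Fin m → ℝ) × Pt d | ∀ j, |inner ℝ (E j) q.2 - (p + q.1) j| ≤ w} := by
      simp only [ofPred_forall]
      refine MeasurableSet.iInter fun j => (isClosed_le ?_ continuous_const).measurableSet
      have : Continuous fun q : (Fin m → ℝ) × Pt d => (p + q.1) j := by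
        simp only [Pi.add_apply]; fun_prop
      exact ((continuous_const.inner continuous_snd).sub this).abs
    exact (measurable_fst measurableSet_Icc).inter ((measurable_snd hU).inter h1)
  have hvI : volume I = ENNReal.ofReal ((2 * ρ) ^ m) := by
    rw [hI, Real.volume_Icc_pi, ← ENNReal.ofReal_prod_of_nonneg (fun i _ => by linarith)]
    congr 1
    simp [two_mul]
  calc c * ENNReal.ofReal ((2 * ρ) ^ m) = ∫⁻ _ in I, c := by rw [setLIntegral_const, hvI]
    _ ≤ ∫⁻ y in I, volume (Prod.mk y ⁻¹' Q) := by
        refine setLIntegral_mono' measurableSet_Icc fun y hy => ?_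
        refine (hc y ((hIm y).1 hy)).trans (measure_mono fun x hx => ⟨hy, hx.1, hx.2⟩)
    _ ≤ ∫⁻ y, volume (Prod.mk y ⁻¹' Q) := setLIntegral_le_lintegral _ _
    _ = (volume.prod volume) Q := (Measure.prod_apply hQm).symm
    _ = ∫⁻ x, volume ((fun y => (y, x)) ⁻¹' Q) := Measure.prod_apply_symm hQm
    _ ≤ ∫⁻ x, (U ∩ slab E p (ρ + w)).indicator (fun _ => ENNReal.ofReal ((2 * w) ^ m)) x := by
        refine lintegral_mono fun x => ?_
        by_cases hx : x ∈ U ∩ slab E p (ρ + w)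
        · rw [indicator_of_mem hx]
          have : (fun y => (y, x)) ⁻¹' Q ⊆ Icc (fun j => inner ℝ (E j) x - p j - w)
              (fun j => inner ℝ (E j) x - p j + w) := by
            rintro y ⟨-, -, h⟩
            simp only [mem_Icc, Pi.le_def]
            refine ⟨fun j => ?_, fun j => ?_⟩ <;>
            · have := abs_le.1 (h j)
              simp only [Pi.add_apply] at this
              linarith
          refine (measure_mono this).trans (le_of_eq ?_)
          rw [Real.volume_Icc_pi, ← ENNReal.ofReal_prod_of_nonneg (fun i _ => by linarith)]
          congr 1
          rw [Finset.prod_congr rfl fun j _ => show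
            (inner ℝ (E j) x - p j + w) - (inner ℝ (E j) x - p j - w) = 2 * w by ring]
          simp
        · rw [indicator_of_notMem hx, nonpos_iff_eq_zero]
          convert measure_empty (μ := volume)
          refine eq_empty_of_forall_notMem fun y hy => hx ⟨hy.2.1, fun j => ?_⟩
          have h1 := hy.2.2 j
          have h2 := (hIm y).1 hy.1 j
          simp only [Pi.add_apply] at h1
          rw [abs_le] at *
          constructor <;> linarith
    _ = _ := by
        rw [lintegral_indicator (hU.inter (isClosed_slab E p _).measurableSet), setLIntegral_const]

lemma norm_le_of_mem_cellUnion {d : ℕ} (hd : 0 < d) {n : ℕ} {S : Finset (Fin d → ℤ)}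
    (hS : ∀ z ∈ S, IsUnitIndex n z) {x : Pt d} (hx : x ∈ cellUnion n S) : ‖x‖ ≤ cellRadius d := by
  simp only [cellUnion, mem_iUnion] at hx
  obtain ⟨z, hz, hx⟩ := hx
  exact norm_le_cellRadius hd (hS z hz) (cell_subset_closedCell n z hx)

lemma exists_near_face {d : ℕ} {n : ℕ} {S : Finset (Fin d → ℤ)}
    (hS : ∀ z ∈ S, IsUnitIndex n z) {R : ℝ} {x y : Pt d} (hxR : ‖x‖ ≤ R) (hyR : ‖y‖ ≤ R)
    (hy : y ∈ cellUnion n S) (hx : x ∉ cellUnion n S) :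
    ∃ (i : Fin d) (a : ℕ), a < 2 ^ n + 1 ∧
      |shear 1 x i - a / 2 ^ n| ≤ (1 + 4 * R) * ‖x - y‖ := by
  simp only [cellUnion, mem_iUnion, exists_prop] at hx hy
  push Not at hx
  obtain ⟨z, hz, hy⟩ := hy
  have h1 := hx z hz
  simp only [cell, mem_ofPred_eq, not_forall] at h1
  obtain ⟨i, hi⟩ := h1
  have h2 : (0 : ℝ) < 2 ^ n := by positivity
  have hlip := abs_shear_sub_le (σ := 1) (by simp) hxR hyR i
  obtain ⟨hz0, hz1⟩ := hS z hz i
  have hzi : (((z i).toNat : ℕ) : ℝ) = z i := by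
    exact_mod_cast congrArg (Int.cast : ℤ → ℝ) (Int.toNat_of_nonneg hz0)
  have hyi := hy i
  have hfl := Int.floor_le (2 ^ n * shear 1 y i)
  have hlt := Int.lt_floor_add_one (2 ^ n * shear 1 y i)
  rw [hyi] at hfl hlt
  rcases lt_or_gt_of_ne hi with hi | hi
  · have h3 : 2 ^ n * shear 1 x i < z i := Int.floor_lt.1 hi
    refine ⟨i, (z i).toNat, ?_, ?_⟩
    · zify
      rw [Int.toNat_of_nonneg hz0]
      linarith
    · rw [hzi]
      refine le_trans ?_ hlip
      have h5 : shear 1 x i < z i / 2 ^ n := by rw [lt_div_iff₀ h2]; linarith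
      have h6 : z i / 2 ^ n ≤ shear 1 y i := by rw [div_le_iff₀ h2]; linarith
      rw [abs_of_neg (by linarith), abs_of_neg (by linarith)]
      linarith
  · have h3 : ((z i + 1 : ℤ) : ℝ) ≤ 2 ^ n * shear 1 x i := Int.le_floor.1 hi
    refine ⟨i, (z i).toNat + 1, ?_, ?_⟩
    · zify
      rw [Int.toNat_of_nonneg hz0]
      linarith
    · push_cast at h3 ⊢
      rw [hzi]
      refine le_trans ?_ hlip
      have h5 : (z i + 1) / 2 ^ n ≤ shear 1 x i := by rw [div_le_iff₀ h2]; linarith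
      have h6 : shear 1 y i < (z i + 1) / 2 ^ n := by rw [lt_div_iff₀ h2]; linarith
      rw [abs_of_nonneg (by linarith), abs_of_nonneg (by linarith)]
      linarith

lemma volume_inter_slab_translate_le {d m k : ℕ} (hdmk : d = m + k) (hk : 1 ≤ k) :
    ∃ C : ℝ, 0 ≤ C ∧ ∀ (n : ℕ) (S : Finset (Fin d → ℤ)), (∀ z ∈ S, IsUnitIndex n z) →
      ∀ (E : Fin m → Pt d), Orthonormal ℝ E → ∀ (p y : Fin m → ℝ) (w ρ : ℝ), 0 ≤ w → 0 ≤ ρ →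
        (∀ j, |y j| ≤ ρ) →
        volume (cellUnion n S ∩ slab E p w) ≤ volume (cellUnion n S ∩ slab E (p + y) w) +
          ENNReal.ofReal (C * 2 ^ n * w ^ m * √ρ) := by
  have hd : 0 < d := by omega
  have hcR := one_le_cellRadius hd
  set R := cellRadius d + 1 with hR
  obtain ⟨C₀, hC₀, hface⟩ := volume_face_le hdmk hk (R := R) (by linarith)
  set L := (1 + 4 * R) * m with hL
  have hL0 : 0 ≤ L := by positivity
  refine ⟨(2 ^ m * (2 * cellRadius d) ^ k) * √L + d * 2 * C₀ * √L, by positivity,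
    fun n S hS E hE p y w ρ hw hρ hy => ?_⟩
  have hn1 : (1 : ℝ) ≤ 2 ^ n := one_le_pow₀ (by norm_num)
  by_cases hLρ : 1 ≤ L * ρ
  · refine (volume_inter_slab_le hdmk hE p hw (by linarith : (0 : ℝ) ≤ cellRadius d) (x₀ := 0)
      fun x hx => by simpa using norm_le_of_mem_cellUnion hd hS hx).trans ?_
    refine le_add_left (ENNReal.ofReal_le_ofReal ?_)
    have h1 : 1 ≤ √L * √ρ := by
      rw [← Real.sqrt_mul hL0, Real.one_le_sqrt]; exact hLρ
    have h2 : 0 ≤ d * 2 * C₀ * √L * 2 ^ n * w ^ m * √ρ := by positivity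
    have h3 : 1 ≤ 2 ^ n * (√L * √ρ) := one_le_mul_of_one_le_of_one_le hn1 h1
    have h4 : 0 ≤ 2 ^ m * (2 * cellRadius d) ^ k * w ^ m := by positivity
    rw [mul_pow 2 w]
    nlinarith [mul_le_mul_of_nonneg_left h3 h4]
  · replace hLρ := (not_le.1 hLρ).le
    set Y : Pt d := ∑ j, y j • E j with hY
    have hYn : ‖Y‖ ≤ m * ρ := by
      refine (norm_sum_le _ _).trans ((Finset.sum_le_sum fun j _ => ?_).trans_eq
        (by simp : ∑ _j : Fin m, ρ = m * ρ))
      rw [norm_smul, hE.1, mul_one]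
      exact hy j
    have hEY : ∀ j, inner ℝ (E j) Y = y j := fun j => hE.inner_right_fintype y j
    have hLY : (1 + 4 * R) * ‖Y‖ ≤ L * ρ := by
      rw [hL, mul_assoc]; gcongr
    have hY1 : ‖Y‖ ≤ 1 := by
      have : ‖Y‖ ≤ (1 + 4 * R) * ‖Y‖ := le_mul_of_one_le_left (norm_nonneg _) (by linarith)
      linarith
    set U := cellUnion n S with hU
    set F : Fin d → ℕ → Set (Pt d) := fun i a =>
      {x | ‖x‖ ≤ R ∧ |shear 1 x i - a / 2 ^ n| ≤ L * ρ} ∩ slab E (p + y) w with hF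
    have hcover : (fun x => x + -Y) ⁻¹' (U ∩ slab E p w) ⊆ (U ∩ slab E (p + y) w) ∪
        ⋃ i ∈ (Finset.univ : Finset (Fin d)), ⋃ a ∈ Finset.range (2 ^ n + 1), F i a := by
      rintro x ⟨hx, hx'⟩
      have hxs : x ∈ slab E (p + y) w := fun j => by
        have := hx' j
        rw [inner_add_right, inner_neg_right, hEY] at this
        rw [Pi.add_apply]
        convert this using 2
        ring
      by_cases hxU : x ∈ U
      · exact Or.inl ⟨hxU, hxs⟩
      · right
        have h1 : ‖x + -Y‖ ≤ cellRadius d := norm_le_of_mem_cellUnion hd hS hx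
        have h2 : ‖x‖ ≤ R := by
          have := norm_add_le (x + -Y) Y
          rw [neg_add_cancel_right] at this
          linarith
        obtain ⟨i, a, ha, hia⟩ := exists_near_face hS h2 (h1.trans (by linarith)) hx hxU
        simp only [mem_iUnion, exists_prop, Finset.mem_univ, true_and, Finset.mem_range]
        refine ⟨i, a, ha, ⟨h2, hia.trans ?_⟩, hxs⟩
        simpa using hLY
    have hmp : volume (U ∩ slab E p w) = volume ((fun x => x + -Y) ⁻¹' (U ∩ slab E p w)) :=
      (measure_preimage_add_right volume (-Y) _).symm
    rw [hmp]
    refine (measure_mono hcover).trans ((measure_union_le _ _).trans ?_)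
    gcongr
    calc volume (⋃ i ∈ (Finset.univ : Finset (Fin d)), ⋃ a ∈ Finset.range (2 ^ n + 1), F i a)
        ≤ ∑ i : Fin d, ∑ a ∈ Finset.range (2 ^ n + 1), volume (F i a) :=
          (measure_biUnion_finset_le _ _).trans
            (Finset.sum_le_sum fun i _ => measure_biUnion_finset_le _ _)
      _ ≤ ∑ i : Fin d, ∑ a ∈ Finset.range (2 ^ n + 1), ENNReal.ofReal (C₀ * w ^ m * √(L * ρ)) :=
          Finset.sum_le_sum fun i _ => Finset.sum_le_sum fun a _ =>
            hface E hE (p + y) w hw i (a / 2 ^ n) (L * ρ) (by positivity) hLρ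
      _ = ENNReal.ofReal (d * ((2 ^ n + 1) * (C₀ * w ^ m * √(L * ρ)))) := by
          simp only [Finset.sum_const, Finset.card_univ, Fintype.card_fin, Finset.card_range,
            nsmul_eq_mul]
          have h1 : ENNReal.ofReal (2 ^ n + 1) = ((2 ^ n + 1 : ℕ) : ℝ≥0∞) := by
            rw [← ENNReal.ofReal_natCast]; simp
          rw [ENNReal.ofReal_mul (p := (d : ℝ)) (by positivity),
            ENNReal.ofReal_mul (p := 2 ^ n + 1) (by positivity), ENNReal.ofReal_natCast, h1]
      _ ≤ _ := by
          apply ENNReal.ofReal_le_ofReal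
          rw [Real.sqrt_mul hL0]
          have h1 : d * ((2 ^ n + 1) * (C₀ * w ^ m * (√L * √ρ))) ≤
              d * ((2 ^ n + 2 ^ n) * (C₀ * w ^ m * (√L * √ρ))) := by gcongr
          have h2 : 0 ≤ 2 ^ m * (2 * cellRadius d) ^ k * √L * 2 ^ n * w ^ m * √ρ := by positivity
          linarith

/-- A thin slab can be replaced by a thicker one with almost the same density. -/
lemma volume_inter_thin_slab_le {d m k : ℕ} (hdmk : d = m + k) (hk : 1 ≤ k) :
    ∃ C : ℝ, 0 ≤ C ∧ ∀ (n : ℕ) (S : Finset (Fin d → ℤ)), (∀ z ∈ S, IsUnitIndex n z) →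
      ∀ (E : Fin m → Pt d), Orthonormal ℝ E → ∀ (p : Fin m → ℝ) (w ρ : ℝ), 0 ≤ w → 0 < ρ →
        volume.real (cellUnion n S ∩ slab E p w) ≤
          (w / ρ) ^ m * volume.real (cellUnion n S ∩ slab E p (ρ + w)) +
          C * 2 ^ n * w ^ m * √ρ := by
  obtain ⟨C, hC, H⟩ := volume_inter_slab_translate_le hdmk hk
  have hd : 0 < d := by omega
  refine ⟨C, hC, fun n S hS E hE p w ρ hw hρ => ?_⟩
  have hfin : ∀ p w, volume (cellUnion n S ∩ slab E p w) ≠ ∞ := fun p w => by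
    refine ne_top_of_le_ne_top (b := volume (closedBall (0 : Pt d) (cellRadius d)))
      measure_closedBall_lt_top.ne (measure_mono fun x hx => ?_)
    simpa using norm_le_of_mem_cellUnion hd hS hx.1
  set err := C * 2 ^ n * w ^ m * √ρ with herr
  have herr0 : 0 ≤ err := by positivity
  have h := mul_volume_inter_slab_le (E := E) (p := p) hw hρ.le (measurableSet_cellUnion n S)
    (c := volume (cellUnion n S ∩ slab E p w) - ENNReal.ofReal err)
    fun y hy => tsub_le_iff_right.2 (H n S hS E hE p y w ρ hw hρ.le hy)
  have h1 := ENNReal.toReal_mono (ENNReal.mul_ne_top ENNReal.ofReal_ne_top (hfin p (ρ + w))) h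
  rw [ENNReal.toReal_mul, ENNReal.toReal_mul, ENNReal.toReal_ofReal (by positivity),
    ENNReal.toReal_ofReal (by positivity)] at h1
  have h2 := ENNReal.le_toReal_sub (a := volume (cellUnion n S ∩ slab E p w))
    (b := ENNReal.ofReal err) ENNReal.ofReal_ne_top
  rw [ENNReal.toReal_ofReal herr0] at h2
  change volume.real (cellUnion n S ∩ slab E p w) - err ≤ _ at h2
  change _ ≤ _ * volume.real (cellUnion n S ∩ slab E p (ρ + w)) at h1
  have h3 := (mul_le_mul_of_nonneg_right h2 (by positivity : 0 ≤ (2 * ρ) ^ m)).trans h1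
  rw [← le_div_iff₀ (by positivity)] at h3
  have h4 : (2 * w) ^ m * volume.real (cellUnion n S ∩ slab E p (ρ + w)) / (2 * ρ) ^ m =
      (w / ρ) ^ m * volume.real (cellUnion n S ∩ slab E p (ρ + w)) := by
    rw [mul_pow, mul_pow, div_pow]
    field_simp
  rw [h4] at h3
  linarith

lemma exists_finset_net {α ι : Type*} [Fintype ι] (s : Set α) (f : α → ι → ℝ) {B τ : ℝ}
    (hτ : 0 < τ) (hf : ∀ a ∈ s, ∀ i, |f a i| ≤ B) (hB : 0 ≤ B) :
    ∃ P : Finset α, (∀ a ∈ P, a ∈ s) ∧ (P.card : ℝ) ≤ (2 * B / τ + 3) ^ Fintype.card ι ∧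
      ∀ a ∈ s, ∃ b ∈ P, ∀ i, |f a i - f b i| ≤ τ := by
  classical
  set key : α → ι → ℤ := fun a i => ⌊f a i / τ⌋ with hkey
  set F : Finset (ι → ℤ) := Fintype.piFinset fun _ => Finset.Icc ⌊-B / τ⌋ ⌊B / τ⌋ with hF
  have hsub : key '' s ⊆ F := by
    rintro _ ⟨a, ha, rfl⟩
    simp only [hF, Finset.mem_coe, Fintype.mem_piFinset, Finset.mem_Icc, hkey]
    intro i
    have := abs_le.1 (hf a ha i)
    exact ⟨Int.floor_le_floor (by gcongr; exact this.1), Int.floor_le_floor (by gcongr; exact this.2)⟩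
  obtain ⟨t, hts, hbij⟩ := Set.exists_subset_bijOn s key
  have hfin : t.Finite := hbij.finite_iff_finite.2 (F.finite_toSet.subset hsub)
  refine ⟨hfin.toFinset, fun a ha => hts (hfin.mem_toFinset.1 ha), ?_, fun a ha => ?_⟩
  · have h1 : hfin.toFinset.card ≤ F.card :=
      Finset.card_le_card_of_injOn key (fun a ha => hsub ⟨a, hts (hfin.mem_toFinset.1 ha), rfl⟩)
        (by simpa using hbij.injOn)
    have h2 : (F.card : ℝ) = ((⌊B / τ⌋ + 1 - ⌊-B / τ⌋).toNat : ℝ) ^ Fintype.card ι := by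
      simp [hF, Fintype.card_piFinset]
    refine (Nat.cast_le.2 h1).trans ?_
    rw [h2]
    gcongr
    have h3 := Int.floor_le (B / τ)
    have h4 := Int.lt_floor_add_one (-B / τ)
    have h5 : ((⌊B / τ⌋ + 1 - ⌊-B / τ⌋).toNat : ℝ) = ((⌊B / τ⌋ + 1 - ⌊-B / τ⌋ : ℤ) : ℝ) := by
      have : 0 ≤ ⌊B / τ⌋ + 1 - ⌊-B / τ⌋ := by
        have : ⌊-B / τ⌋ ≤ ⌊B / τ⌋ := Int.floor_le_floor (by gcongr; linarith)
        linarith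
      exact_mod_cast congrArg (Int.cast : ℤ → ℝ) (Int.toNat_of_nonneg this)
    rw [h5]
    push_cast
    rw [neg_div] at h4 ⊢
    rw [mul_div_assoc]
    linarith
  · obtain ⟨b, hb, hab⟩ := hbij.surjOn ⟨a, ha, rfl⟩
    refine ⟨b, hfin.mem_toFinset.2 hb, fun i => ?_⟩
    have h1 : ⌊f b i / τ⌋ = ⌊f a i / τ⌋ := congrFun hab i
    have h2 := Int.abs_sub_lt_one_of_floor_eq_floor h1.symm
    rw [← sub_div, abs_div, abs_of_pos hτ, div_lt_one hτ] at h2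
    exact h2.le

lemma one_add_mul_pow_le (m : ℕ) {a x : ℝ} (ha : 0 ≤ a) (hx0 : 0 ≤ x) (hx1 : x ≤ 1) :
    (1 + a * x) ^ m ≤ 1 + (1 + a) ^ m * x := by
  have h := (convexOn_pow m).2 (x := 1) (y := 1 + a) (by simp) (by simp; linarith)
    (by linarith : 0 ≤ 1 - x) hx0 (by ring)
  simp only [smul_eq_mul, one_pow, mul_one] at h
  calc (1 + a * x) ^ m = (1 - x + x * (1 + a)) ^ m := by ring_nf
    _ ≤ 1 - x + x * (1 + a) ^ m := h
    _ ≤ _ := by linarith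

/-- The generation `n` cells with indices in `S` have density at most `M` on the given slab. -/
def DensityLE {d m : ℕ} (n : ℕ) (S : Finset (Fin d → ℤ)) (M : ℝ) (E : Fin m → Pt d)
    (p : Fin m → ℝ) (w : ℝ) : Prop :=
  2 ^ (n * d) * volume.real (cellUnion n S ∩ slab E p w) ≤ M * S.card * w ^ m

/-- The generation `n` cells with indices in `S` have density at most `M` on all slabs of
codimension `m`. -/
def IsSpread {d : ℕ} (m n : ℕ) (S : Finset (Fin d → ℤ)) (M : ℝ) : Prop :=
  ∀ (E : Fin m → Pt d) (p : Fin m → ℝ) (w : ℝ), Orthonormal ℝ E → 0 < w → DensityLE n S M E p w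

lemma volume_cell_lt_top {d : ℕ} (hd : 0 < d) (n : ℕ) (z : Fin d → ℤ) :
    volume (cell n z) < ∞ := by
  by_contra h
  have h1 := volume_cell hd n z
  rw [Measure.real, top_le_iff.1 (not_lt.1 h), ENNReal.toReal_top] at h1
  have : (0 : ℝ) < (2 ^ (n * d))⁻¹ := by positivity
  linarith

lemma volume_cellUnion {d : ℕ} (hd : 0 < d) (n : ℕ) (S : Finset (Fin d → ℤ)) :
    2 ^ (n * d) * volume.real (cellUnion n S) = S.card := by
  have h := volume_cellUnion_inter n S (T := univ) MeasurableSet.univ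
  simp only [inter_univ] at h
  rw [Measure.real, h, ENNReal.toReal_sum fun z _ => (volume_cell_lt_top hd n z).ne]
  have : ∀ z ∈ S, (volume (cell n z)).toReal = (2 ^ (n * d))⁻¹ := fun z _ => volume_cell hd n z
  rw [Finset.sum_congr rfl this, Finset.sum_const, nsmul_eq_mul]
  field_simp

lemma volume_cellUnion_lt_top {d : ℕ} (hd : 0 < d) (n : ℕ) (S : Finset (Fin d → ℤ)) :
    volume (cellUnion n S) < ∞ := by
  have h := volume_cellUnion_inter n S (T := univ) MeasurableSet.univ
  simp only [inter_univ] at h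
  rw [h]
  exact ENNReal.sum_lt_top.2 fun z _ => volume_cell_lt_top hd n z

lemma volume_inter_le_card {d : ℕ} (hd : 0 < d) (n : ℕ) (S : Finset (Fin d → ℤ)) (T : Set (Pt d)) :
    2 ^ (n * d) * volume.real (cellUnion n S ∩ T) ≤ S.card := by
  rw [← volume_cellUnion hd n S]
  gcongr
  exacts [(volume_cellUnion_lt_top hd n S).ne, inter_subset_left]

lemma densityLE_of_one_le {d m : ℕ} (hd : 0 < d) {n : ℕ} {S : Finset (Fin d → ℤ)} {M : ℝ}
    (hM : 1 ≤ M) (E : Fin m → Pt d) (p : Fin m → ℝ) {w : ℝ} (hw : 1 ≤ w) :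
    DensityLE n S M E p w := by
  refine (volume_inter_le_card hd n S _).trans ?_
  have : 1 ≤ M * w ^ m := one_le_mul_of_one_le_of_one_le hM (one_le_pow₀ hw)
  have hc : (0 : ℝ) ≤ S.card := by positivity
  nlinarith

lemma inter_slab_subset_of_near {d m : ℕ} {U : Set (Pt d)} {R τ : ℝ} (hU : ∀ x ∈ U, ‖x‖ ≤ R)
    {E E' : Fin m → Pt d} {p p' : Fin m → ℝ} {w w' : ℝ} (hτ : 0 ≤ τ)
    (hE : ∀ j i, |E j i - E' j i| ≤ τ) (hp : ∀ j, |p j - p' j| ≤ τ) (hw : |w - w'| ≤ τ) :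
    U ∩ slab E p w ⊆ U ∩ slab E' p' (w' + (d * R + 2) * τ) := by
  rintro x ⟨hx, hx'⟩
  refine ⟨hx, fun j => ?_⟩
  have h1 := hx' j
  have h2 : |inner ℝ (E j - E' j) x| ≤ d * τ * R :=
    (abs_real_inner_le_norm _ _).trans (mul_le_mul
      (EuclideanSpace.norm_le_card_mul hτ fun i => by simpa using hE j i) (hU x hx)
      (norm_nonneg _) (by positivity))
  rw [inner_sub_left] at h2
  have h3 := hp j
  rw [abs_le] at *
  constructor <;> linarith

lemma exists_net_of_slabs {d m : ℕ} (hd : 0 < d) {τ : ℝ} (hτ : 0 < τ) :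
    ∃ P : Finset ((Fin m → Pt d) × (Fin m → ℝ) × ℝ),
      (∀ θ ∈ P, Orthonormal ℝ θ.1 ∧ 0 < θ.2.2) ∧
      (P.card : ℝ) ≤ (2 * (cellRadius d + 1) / τ + 3) ^ (m * d + m + 1) ∧
      ∀ (n : ℕ) (S : Finset (Fin d → ℤ)) (B : ℝ), (∀ z ∈ S, IsUnitIndex n z) → 0 ≤ B →
        (∀ θ ∈ P, DensityLE n S B θ.1 θ.2.1 θ.2.2) →
        ∀ (E : Fin m → Pt d) (p : Fin m → ℝ) (w : ℝ), Orthonormal ℝ E → 0 < w → w ≤ 1 →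
          2 ^ (n * d) * volume.real (cellUnion n S ∩ slab E p w) ≤
            B * S.card * (w + (d * cellRadius d + 3) * τ) ^ m := by
  classical
  set R := cellRadius d with hR
  have hR1 : 1 ≤ R := one_le_cellRadius hd
  set s : Set ((Fin m → Pt d) × (Fin m → ℝ) × ℝ) :=
    {θ | Orthonormal ℝ θ.1 ∧ (∀ j, |θ.2.1 j| ≤ R + 1) ∧ 0 < θ.2.2 ∧ θ.2.2 ≤ 1} with hs
  set f : (Fin m → Pt d) × (Fin m → ℝ) × ℝ → (Fin m × Fin d) ⊕ Fin m ⊕ Unit → ℝ :=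
    fun θ => Sum.elim (fun ji => θ.1 ji.1 ji.2) (Sum.elim θ.2.1 fun _ => θ.2.2) with hf
  obtain ⟨P₀, hP₀, hcard, hnet⟩ := exists_finset_net s f hτ (B := R + 1) (by
    rintro ⟨E, p, w⟩ ⟨hE, hp, hw0, hw1⟩ (⟨j, i⟩ | j | _)
    · have h1 : |E j i| ≤ ‖E j‖ := by
        simpa using PiLp.norm_apply_le (E j) i
      rw [hE.1] at h1
      exact h1.trans (by linarith)
    · exact hp j
    · simp only [hf, Sum.elim_inr]
      rw [abs_of_pos hw0]
      linarith) (by linarith)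
  refine ⟨P₀.image fun θ => (θ.1, θ.2.1, θ.2.2 + (d * R + 2) * τ), ?_, ?_, ?_⟩
  · intro θ hθ
    obtain ⟨θ', hθ', rfl⟩ := Finset.mem_image.1 hθ
    obtain ⟨h1, -, h2, -⟩ := hP₀ θ' hθ'
    exact ⟨h1, by positivity⟩
  · refine (Nat.cast_le.2 Finset.card_image_le).trans (hcard.trans_eq ?_)
    congr 1
    simp [add_assoc]
  · intro n S B hS hB hP E p w hE hw0 hw1
    have hU : ∀ x ∈ cellUnion n S, ‖x‖ ≤ R := fun x hx => norm_le_of_mem_cellUnion hd hS hx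
    by_cases hp : ∀ j, |p j| ≤ R + 1
    · obtain ⟨⟨E', p', w'⟩, hθ, hnear⟩ := hnet (E, p, w) ⟨hE, hp, hw0, hw1⟩
      have h1 := hP _ (Finset.mem_image_of_mem _ hθ)
      have hw : |w - w'| ≤ τ := hnear (Sum.inr (Sum.inr ()))
      have h2 := inter_slab_subset_of_near hU hτ.le (E := E) (E' := E') (p := p) (p' := p')
        (fun j i => hnear (Sum.inl (j, i))) (fun j => hnear (Sum.inr (Sum.inl j))) hw
      refine le_trans (mul_le_mul_of_nonneg_left (measureReal_mono h2 ?_) (by positivity))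
        (h1.trans ?_)
      · exact ne_top_of_le_ne_top (volume_cellUnion_lt_top hd n S).ne
          (measure_mono inter_subset_left)
      · have h3 : 0 < w' := (hP₀ _ hθ).2.2.1
        have h4 : w' + (d * R + 2) * τ ≤ w + (d * R + 3) * τ := by
          have := (abs_le.1 hw).1
          linarith
        exact mul_le_mul_of_nonneg_left (pow_le_pow_left₀ (by positivity) h4 _) (by positivity)
    · push Not at hp
      obtain ⟨j, hj⟩ := hp
      have : cellUnion n S ∩ slab E p w = ∅ := by
        refine eq_empty_of_forall_notMem fun x ⟨hx, hx'⟩ => ?_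
        have h1 := hx' j
        have h2 := (abs_real_inner_le_norm (E j) x).trans_eq (by rw [hE.1, one_mul])
        have h4 := hU x hx
        have h3 := abs_sub_abs_le_abs_sub (p j) (inner ℝ (E j) x)
        rw [abs_sub_comm] at h3
        linarith
      rw [this]
      simp
      positivity

/-- Spread of a generation `n` set can be tested on `exp (O(n))` slabs. -/
lemma exists_net_isSpread {d m k : ℕ} (hdmk : d = m + k) (hk : 1 ≤ k) :
    ∃ C : ℝ, 0 ≤ C ∧ ∀ n : ℕ, ∃ P : Finset ((Fin m → Pt d) × (Fin m → ℝ) × ℝ),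
      (∀ θ ∈ P, Orthonormal ℝ θ.1 ∧ 0 < θ.2.2) ∧ (P.card : ℝ) ≤ Real.exp (C * (n + 1)) ∧
      ∀ (S : Finset (Fin d → ℤ)) (B : ℝ), (∀ z ∈ S, IsUnitIndex n z) → 1 ≤ B →
        (∀ θ ∈ P, DensityLE n S B θ.1 θ.2.1 θ.2.2) → IsSpread m n S ((1 + C * (2 ^ n)⁻¹) * B) := by
  have hd : 0 < d := by omega
  obtain ⟨C₁, hC₁, hthin⟩ := volume_inter_thin_slab_le hdmk hk
  set R := cellRadius d with hR
  have hR1 : 1 ≤ R := one_le_cellRadius hd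
  set c : ℝ := d * R + 3 with hc
  have hc0 : 0 ≤ c := by positivity
  set N := m * d + m + 1 with hN
  set A : ℝ := 2 * (R + 1) + 3 with hA
  set K := 2 * d + 6 with hK
  have hm2 : (1 : ℝ) ≤ (1 + 1) ^ m := one_le_pow₀ (by norm_num)
  set C₂ : ℝ := (1 + c) ^ m with hC₂
  set C₃ : ℝ := (1 + 1) ^ m with hC₃
  have hC₂0 : 0 ≤ C₂ := by positivity
  have hC₃0 : 0 ≤ C₃ := by positivity
  refine ⟨N * (A + K) + (C₂ + C₃ + C₂ * C₃ + C₁), by positivity, fun n => ?_⟩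
  have h2n : (0 : ℝ) < 2 ^ n := by positivity
  set ε : ℝ := (2 ^ n)⁻¹ with hε
  have hε0 : 0 < ε := by positivity
  have hε1 : ε ≤ 1 := inv_le_one_of_one_le₀ (one_le_pow₀ (by norm_num))
  obtain ⟨P, hP, hcard, hnet⟩ := exists_net_of_slabs (m := m) hd (τ := ε ^ K) (by positivity)
  refine ⟨P, hP, hcard.trans ?_, fun S B hS hB hPS => ?_⟩
  · have hbase : 2 * (R + 1) / ε ^ K + 3 ≤ Real.exp (A + K * n) := by
      have h1 : (ε ^ K)⁻¹ ≤ Real.exp (K * n) := by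
        rw [hε, inv_pow, inv_inv, ← pow_mul, mul_comm n K]
        calc (2 : ℝ) ^ (K * n) ≤ Real.exp 1 ^ (K * n) := by
              gcongr
              have := Real.add_one_le_exp 1
              linarith
          _ = Real.exp (K * n) := by rw [← Real.exp_nat_mul]; simp
      have h2 : 1 ≤ Real.exp (K * n) := Real.one_le_exp (by positivity)
      have h3 : A ≤ Real.exp A := by
        have := Real.add_one_le_exp A
        linarith
      rw [Real.exp_add]
      calc 2 * (R + 1) / ε ^ K + 3 ≤ 2 * (R + 1) * Real.exp (K * n) + 3 * Real.exp (K * n) := by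
            rw [div_eq_mul_inv]
            gcongr
            linarith
        _ = A * Real.exp (K * n) := by rw [hA]; ring
        _ ≤ _ := by gcongr
    calc (2 * (R + 1) / ε ^ K + 3) ^ N ≤ Real.exp (A + K * n) ^ N := by gcongr
      _ = Real.exp (N * (A + K * n)) := by rw [← Real.exp_nat_mul]
      _ ≤ _ := by
        apply Real.exp_le_exp.2
        have h1 : (0 : ℝ) ≤ n := by positivity
        have h2 : 0 ≤ (N : ℝ) * A * n := by positivity
        have h3 : 0 ≤ (N : ℝ) * K := by positivity
        have h4 : 0 ≤ (C₂ + C₃ + C₂ * C₃ + C₁) * (n + 1) := by positivity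
        nlinarith
  · have hmid : ∀ (E : Fin m → Pt d) (p : Fin m → ℝ) (w : ℝ), Orthonormal ℝ E →
        ε ^ (2 * d + 5) ≤ w →
        2 ^ (n * d) * volume.real (cellUnion n S ∩ slab E p w) ≤
          (1 + C₂ * ε) * B * S.card * w ^ m := by
      intro E p w hE hw
      have hw0 : 0 < w := lt_of_lt_of_le (by positivity) hw
      have h1B : 1 ≤ (1 + C₂ * ε) * B := by
        have : 0 ≤ C₂ * ε * B := by positivity
        linarith
      rcases le_total 1 w with hw1 | hw1
      · exact densityLE_of_one_le hd h1B E p hw1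
      · refine (hnet n S B hS (by linarith) hPS E p w hE hw0 hw1).trans ?_
        have h1 : w + c * ε ^ K ≤ w * (1 + c * ε) := by
          have h2 : ε ^ K = ε ^ (2 * d + 5) * ε := by rw [hK, ← pow_succ]
          have h3 : c * (ε ^ (2 * d + 5) * ε) ≤ c * (w * ε) := by gcongr
          rw [h2]
          linarith
        have h4 : (w + c * ε ^ K) ^ m ≤ w ^ m * (1 + C₂ * ε) := by
          refine (pow_le_pow_left₀ (by positivity) h1 m).trans ?_
          rw [mul_pow]
          gcongr
          exact one_add_mul_pow_le m hc0 hε0.le hε1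
        calc B * S.card * (w + c * ε ^ K) ^ m ≤ B * S.card * (w ^ m * (1 + C₂ * ε)) := by gcongr
          _ = _ := by ring
    have hfinal : (1 + C₃ * ε) * (1 + C₂ * ε) * B + C₁ * ε ≤
        (1 + (N * (A + K) + (C₂ + C₃ + C₂ * C₃ + C₁)) * ε) * B := by
      have h1 : C₂ * C₃ * (ε * ε) * B ≤ C₂ * C₃ * (ε * 1) * B := by gcongr
      have h2 : C₁ * ε * 1 ≤ C₁ * ε * B := by gcongr
      have h3 : 0 ≤ (N * (A + K)) * ε * B := by positivity
      linarith
    intro E p w hE hw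
    unfold DensityLE
    have hw0 : 0 ≤ w ^ m := by positivity
    rcases S.eq_empty_or_nonempty with rfl | hSne
    · simp [cellUnion]
    have hS1 : (1 : ℝ) ≤ S.card := by exact_mod_cast hSne.card_pos
    have hfin := mul_le_mul_of_nonneg_right hfinal (by positivity : 0 ≤ S.card * w ^ m)
    have hCe : 0 ≤ C₃ * ε * (1 + C₂ * ε) * B * (S.card * w ^ m) := by positivity
    have hCe1 : 0 ≤ C₁ * ε * (S.card * w ^ m) := by positivity
    rcases le_total (ε ^ (2 * d + 5)) w with hw1 | hw1
    · have := hmid E p w hE hw1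
      linarith
    · set ρ := ε ^ (2 * d + 4) with hρ
      have hρ0 : 0 < ρ := by positivity
      have hwρ : w ≤ ρ * ε := by rw [hρ, ← pow_succ]; exact hw1
      have h1 := hthin n S hS E hE p w ρ hw.le hρ0
      have h2 := hmid E p (ρ + w) hE (by
        have : ε ^ (2 * d + 5) ≤ ρ := by
          rw [pow_succ]
          exact mul_le_of_le_one_right hρ0.le hε1
        linarith)
      have h3 : (ρ + w) ^ m ≤ ρ ^ m * (1 + C₃ * ε) := by
        have : ρ + w ≤ ρ * (1 + 1 * ε) := by linarith
        refine (pow_le_pow_left₀ (by positivity) this m).trans ?_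
        rw [mul_pow]
        gcongr
        exact one_add_mul_pow_le m zero_le_one hε0.le hε1
      have h4 : √ρ = ε ^ (d + 2) := by
        rw [hρ, show 2 * d + 4 = (d + 2) * 2 by ring, pow_mul, Real.sqrt_sq (by positivity)]
      have h5 : (2 : ℝ) ^ (n * d) * (C₁ * 2 ^ n * w ^ m * √ρ) = C₁ * ε * w ^ m := by
        have : (2 : ℝ) ^ (n * d) * 2 ^ n * ε ^ (d + 2) = ε := by
          have h6 : (2 : ℝ) ^ (n * d) * 2 ^ n = (2 ^ n) ^ (d + 1) := by
            rw [← pow_mul, ← pow_add]; ring_nf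
          rw [h6, show ε ^ (d + 2) = ε ^ (d + 1) * ε by rw [← pow_succ], ← mul_assoc, ← mul_pow, hε,
            mul_inv_cancel₀ h2n.ne', one_pow, one_mul]
        rw [h4]
        linear_combination C₁ * w ^ m * this
      calc 2 ^ (n * d) * volume.real (cellUnion n S ∩ slab E p w)
          ≤ 2 ^ (n * d) * ((w / ρ) ^ m * volume.real (cellUnion n S ∩ slab E p (ρ + w)) +
            C₁ * 2 ^ n * w ^ m * √ρ) := by gcongr
        _ = (w / ρ) ^ m * (2 ^ (n * d) * volume.real (cellUnion n S ∩ slab E p (ρ + w))) +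
            C₁ * ε * w ^ m := by rw [mul_add, h5]; ring
        _ ≤ (w / ρ) ^ m * ((1 + C₂ * ε) * B * S.card * (ρ ^ m * (1 + C₃ * ε))) +
            C₁ * ε * w ^ m * S.card := by
          refine add_le_add (mul_le_mul_of_nonneg_left (h2.trans ?_) (by positivity))
            (le_mul_of_one_le_right (by positivity) hS1)
          exact mul_le_mul_of_nonneg_left h3 (by positivity)
        _ = ((1 + C₃ * ε) * (1 + C₂ * ε) * B + C₁ * ε) * (S.card * w ^ m) := by
          rw [div_pow]
          field_simp
        _ ≤ _ := hfin
        _ = _ := by ring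

lemma Real.exp_le_add_exp_sq (x : ℝ) : Real.exp x ≤ x + Real.exp (x ^ 2) := by
  have h1 := Real.add_one_le_exp (x ^ 2)
  rcases le_or_gt |x| 1 with hx | hx
  · have := (abs_le.1 (Real.abs_exp_sub_one_sub_id_le hx)).2
    linarith
  · rcases lt_abs.1 hx with hx | hx
    · have : Real.exp x ≤ Real.exp (x ^ 2) := Real.exp_le_exp.2 (by nlinarith)
      linarith
    · have : Real.exp x ≤ 1 := Real.exp_le_one_iff.2 (by linarith)
      nlinarith

lemma sum_exp_sub_mean_le {κ : Type*} [Fintype κ] [Nonempty κ] {f : κ → ℝ} {q s g : ℝ}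
    (hq : ∀ j, |f j| ≤ q) (hg : ∑ j, f j = Fintype.card κ * g) :
    ∑ j, Real.exp (s * (f j - g)) ≤ Fintype.card κ * Real.exp (4 * s ^ 2 * q ^ 2) := by
  have hκ : (0 : ℝ) < Fintype.card κ := by exact_mod_cast Fintype.card_pos
  have hgq : |g| ≤ q := by
    have h1 : |∑ j, f j| ≤ Fintype.card κ * q := by
      refine (Finset.abs_sum_le_sum_abs _ _).trans ?_
      simpa using Finset.sum_le_card_nsmul Finset.univ (fun j => |f j|) q fun j _ => hq j
    rw [hg, abs_mul, abs_of_pos hκ] at h1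
    exact le_of_mul_le_mul_left h1 hκ
  calc ∑ j, Real.exp (s * (f j - g))
      ≤ ∑ j, (s * (f j - g) + Real.exp (4 * s ^ 2 * q ^ 2)) := by
        refine Finset.sum_le_sum fun j _ => (Real.exp_le_add_exp_sq _).trans ?_
        gcongr
        have h1 : |f j - g| ≤ 2 * q := (abs_sub _ _).trans (by linarith [hq j])
        have h2 : (f j - g) ^ 2 ≤ (2 * q) ^ 2 := sq_le_sq' (by linarith [(abs_le.1 h1).1])
          (abs_le.1 h1).2
        rw [mul_pow]
        nlinarith [mul_le_mul_of_nonneg_left h2 (sq_nonneg s)]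
    _ = _ := by
        rw [Finset.sum_add_distrib, ← Finset.mul_sum, Finset.sum_sub_distrib, hg]
        simp

/-- Among all choices of one element of `κ` for each `i`, one does not exceed the average by much
simultaneously for all tests in `P`. -/
lemma exists_choice_sum_le {T ι κ : Type*} [Fintype ι] [DecidableEq ι] [Fintype κ] [Nonempty κ]
    (P : Finset T) (f : T → ι → κ → ℝ) (q g : T → ι → ℝ) {V Λ s : ℝ} (hs : 0 < s)
    (hq : ∀ θ ∈ P, ∀ i j, |f θ i j| ≤ q θ i)
    (hg : ∀ θ ∈ P, ∀ i, ∑ j, f θ i j = Fintype.card κ * g θ i)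
    (hV : ∀ θ ∈ P, ∑ i, q θ i ^ 2 ≤ V) (hP : (P.card : ℝ) ≤ Real.exp Λ) :
    ∃ c : ι → κ, ∀ θ ∈ P, ∑ i, f θ i (c i) ≤ ∑ i, g θ i + Λ / s + 4 * s * V := by
  by_contra hcon
  push Not at hcon
  have hκ : (0 : ℝ) < Fintype.card κ := by exact_mod_cast Fintype.card_pos
  have h1 : ∀ c : ι → κ, Real.exp (Λ + 4 * s ^ 2 * V) <
      ∑ θ ∈ P, ∏ i, Real.exp (s * (f θ i (c i) - g θ i)) := by
    intro c
    obtain ⟨θ, hθ, hlt⟩ := hcon c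
    refine lt_of_lt_of_le ?_ (Finset.single_le_sum
      (f := fun θ => ∏ i, Real.exp (s * (f θ i (c i) - g θ i))) (fun θ _ => by positivity) hθ)
    rw [← Real.exp_sum, ← Finset.mul_sum, Finset.sum_sub_distrib]
    apply Real.exp_lt_exp.2
    have h2 : s * (Λ / s + 4 * s * V) = Λ + 4 * s ^ 2 * V := by field_simp
    nlinarith
  have h2 : ∑ c : ι → κ, ∑ θ ∈ P, ∏ i, Real.exp (s * (f θ i (c i) - g θ i)) ≤
      (Fintype.card κ : ℝ) ^ Fintype.card ι * Real.exp (Λ + 4 * s ^ 2 * V) := by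
    rw [Finset.sum_comm]
    calc ∑ θ ∈ P, ∑ c : ι → κ, ∏ i, Real.exp (s * (f θ i (c i) - g θ i))
        ≤ ∑ θ ∈ P, (Fintype.card κ : ℝ) ^ Fintype.card ι * Real.exp (4 * s ^ 2 * V) := by
          refine Finset.sum_le_sum fun θ hθ => ?_
          rw [← Fintype.prod_sum fun i j => Real.exp (s * (f θ i j - g θ i))]
          calc ∏ i, ∑ j, Real.exp (s * (f θ i j - g θ i))
              ≤ ∏ i, (Fintype.card κ * Real.exp (4 * s ^ 2 * q θ i ^ 2)) :=
                Finset.prod_le_prod (fun i _ => by positivity)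
                  fun i _ => sum_exp_sub_mean_le (hq θ hθ i) (hg θ hθ i)
            _ = (Fintype.card κ : ℝ) ^ Fintype.card ι *
                  Real.exp (4 * s ^ 2 * ∑ i, q θ i ^ 2) := by
                rw [Finset.prod_mul_distrib, ← Real.exp_sum, ← Finset.mul_sum]
                simp
            _ ≤ _ := by
                gcongr
                exact hV θ hθ
      _ = P.card * ((Fintype.card κ : ℝ) ^ Fintype.card ι * Real.exp (4 * s ^ 2 * V)) := by
          rw [Finset.sum_const, nsmul_eq_mul]
      _ ≤ Real.exp Λ * ((Fintype.card κ : ℝ) ^ Fintype.card ι * Real.exp (4 * s ^ 2 * V)) := by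
          gcongr
      _ = _ := by rw [Real.exp_add]; ring
  have h3 := Finset.sum_lt_sum_of_nonempty (s := (Finset.univ : Finset (ι → κ)))
    Finset.univ_nonempty fun c _ => h1 c
  rw [Finset.sum_const, nsmul_eq_mul, Finset.card_univ, Fintype.card_fun] at h3
  push_cast at h3
  linarith

/-- The index of a generation `n + 1` cell inside the generation `n` cell with index `z`. -/
def child {d : ℕ} (z : Fin d → ℤ) (c : Fin d → Fin 2) : Fin d → ℤ := fun i => 2 * z i + (c i : ℕ)

/-- The index of the generation `n` cell containing the generation `n + 1` cell with index `z`. -/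
def parent {d : ℕ} (z : Fin d → ℤ) : Fin d → ℤ := fun i => z i / 2

@[simp] lemma parent_child {d : ℕ} (z : Fin d → ℤ) (c : Fin d → Fin 2) :
    parent (child z c) = z := by
  funext i
  have := (c i).2
  simp only [parent, child]
  omega

lemma child_injective {d : ℕ} (z : Fin d → ℤ) : Function.Injective (child z) := by
  intro c c' h
  funext i
  have := congrFun h i
  simp only [child] at this
  ext
  omega

lemma exists_child_parent {d : ℕ} (z : Fin d → ℤ) : ∃ c, child (parent z) c = z := by
  refine ⟨fun i => ⟨(z i % 2).toNat, by omega⟩, ?_⟩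
  funext i
  simp only [child, parent]
  omega

lemma isUnitIndex_child {d n : ℕ} {z : Fin d → ℤ} (hz : IsUnitIndex n z) (c : Fin d → Fin 2) :
    IsUnitIndex (n + 1) (child z c) := by
  intro i
  have h1 := hz i
  have := (c i).2
  simp only [child, pow_succ]
  omega

lemma cell_subset_cell_parent {d : ℕ} (n : ℕ) (z : Fin d → ℤ) :
    cell (n + 1) z ⊆ cell n (parent z) := by
  intro x hx i
  have h := hx i
  simp only [parent, ← h]
  rw [Int.floor_eq_iff] at h ⊢
  rw [pow_succ, mul_comm ((2 : ℝ) ^ n) 2, mul_assoc] at *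
  set y := 2 ^ n * shear 1 x i
  have h1 := Int.floor_le (2 * y)
  have h2 := Int.lt_floor_add_one (2 * y)
  set a := ⌊2 * y⌋
  have h3 : 2 * (a / 2) ≤ a := by omega
  have h4 : a + 1 ≤ 2 * (a / 2) + 2 := by omega
  have h3' : (2 : ℝ) * ((a / 2 : ℤ) : ℝ) ≤ a := by exact_mod_cast h3
  have h4' : (a : ℝ) + 1 ≤ 2 * ((a / 2 : ℤ) : ℝ) + 2 := by exact_mod_cast h4
  constructor <;> linarith

lemma mem_cell_floor {d : ℕ} (n : ℕ) (x : Pt d) : x ∈ cell n fun i => ⌊2 ^ n * shear 1 x i⌋ :=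
  fun _ => rfl

lemma cell_eq_iUnion_child {d : ℕ} (n : ℕ) (z : Fin d → ℤ) :
    cell n z = ⋃ c, cell (n + 1) (child z c) := by
  ext x
  rw [mem_iUnion]
  constructor
  · intro hx
    obtain ⟨c, hc⟩ := exists_child_parent fun i => ⌊2 ^ (n + 1) * shear 1 x i⌋
    have h1 := cell_subset_cell_parent n _ (mem_cell_floor (n + 1) x)
    have h2 : parent (fun i => ⌊2 ^ (n + 1) * shear 1 x i⌋) = z := by
      funext i
      rw [← h1 i, hx i]
    rw [h2] at hc
    exact ⟨c, hc ▸ mem_cell_floor (n + 1) x⟩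
  · rintro ⟨c, hc⟩
    simpa using cell_subset_cell_parent n _ hc

lemma sum_volume_child_inter {d : ℕ} (hd : 0 < d) (n : ℕ) (z : Fin d → ℤ) {T : Set (Pt d)}
    (hT : MeasurableSet T) :
    ∑ c, volume.real (cell (n + 1) (child z c) ∩ T) = volume.real (cell n z ∩ T) := by
  have h : volume (cell n z ∩ T) = ∑ c, volume (cell (n + 1) (child z c) ∩ T) := by
    rw [cell_eq_iUnion_child, iUnion_inter, measure_iUnion, tsum_fintype]
    · intro c c' hne
      exact (pairwiseDisjoint_cell (n + 1) univ (mem_univ _) (mem_univ _)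
        ((child_injective z).ne hne)).mono inter_subset_left inter_subset_left
    · exact fun c => (measurableSet_cell _ _).inter hT
  rw [Measure.real, h, ENNReal.toReal_sum]
  · rfl
  · exact fun c _ => ne_top_of_le_ne_top (volume_cell_lt_top hd _ _).ne
      (measure_mono inter_subset_left)

lemma sum_volume_cell_inter {d : ℕ} (hd : 0 < d) (n : ℕ) (S : Finset (Fin d → ℤ)) {T : Set (Pt d)}
    (hT : MeasurableSet T) :
    volume.real (cellUnion n S ∩ T) = ∑ z ∈ S, volume.real (cell n z ∩ T) := by
  rw [Measure.real, volume_cellUnion_inter n S hT, ENNReal.toReal_sum]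
  · rfl
  · exact fun c _ => ne_top_of_le_ne_top (volume_cell_lt_top hd _ _).ne
      (measure_mono inter_subset_left)

/-- All children of the elements of `S`. -/
def allChildren {d : ℕ} (S : Finset (Fin d → ℤ)) : Finset (Fin d → ℤ) :=
  S.biUnion fun z => Finset.univ.image (child z)

lemma mem_allChildren {d : ℕ} {S : Finset (Fin d → ℤ)} {z : Fin d → ℤ} :
    z ∈ allChildren S ↔ parent z ∈ S := by
  simp only [allChildren, Finset.mem_biUnion, Finset.mem_image, Finset.mem_univ, true_and]
  constructor
  · rintro ⟨z, hz, c, rfl⟩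
    simpa using hz
  · exact fun h => ⟨parent z, h, exists_child_parent z⟩

lemma card_filter_parent_allChildren {d : ℕ} {S : Finset (Fin d → ℤ)} {z : Fin d → ℤ}
    (hz : z ∈ S) : ((allChildren S).filter fun z' => parent z' = z).card = 2 ^ d := by
  have : ((allChildren S).filter fun z' => parent z' = z) = Finset.univ.image (child z) := by
    ext z'
    simp only [Finset.mem_filter, mem_allChildren, Finset.mem_image, Finset.mem_univ, true_and]
    constructor
    · rintro ⟨-, rfl⟩
      exact exists_child_parent z'
    · rintro ⟨c, rfl⟩
      simpa using hz
  rw [this, Finset.card_image_of_injective _ (child_injective z)]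
  simp

lemma card_allChildren {d : ℕ} (S : Finset (Fin d → ℤ)) :
    (allChildren S).card = 2 ^ d * S.card := by
  rw [Finset.card_eq_sum_card_fiberwise (f := parent) (t := S) fun z hz => mem_allChildren.1 hz,
    Finset.sum_congr rfl fun z hz => card_filter_parent_allChildren hz]
  simp [mul_comm]

lemma cellUnion_allChildren {d : ℕ} (n : ℕ) (S : Finset (Fin d → ℤ)) :
    cellUnion (n + 1) (allChildren S) = cellUnion n S := by
  ext x
  simp only [cellUnion, mem_iUnion, exists_prop, mem_allChildren]
  constructor
  · rintro ⟨z, hz, hx⟩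
    exact ⟨_, hz, cell_subset_cell_parent n z hx⟩
  · rintro ⟨z, hz, hx⟩
    rw [cell_eq_iUnion_child, mem_iUnion] at hx
    obtain ⟨c, hc⟩ := hx
    exact ⟨child z c, by simpa using hz, hc⟩

lemma IsSpread.allChildren {d m n : ℕ} {S : Finset (Fin d → ℤ)} {M : ℝ} (h : IsSpread m n S M) :
    IsSpread m (n + 1) (allChildren S) M := by
  intro E p w hE hw
  have := h E p w hE hw
  unfold DensityLE at *
  rw [cellUnion_allChildren, card_allChildren, add_mul, one_mul, pow_add]
  push_cast
  have h2 : (0 : ℝ) < 2 ^ d := by positivity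
  nlinarith

lemma mem_slab_of_norm_sub_le {d m : ℕ} {E : Fin m → Pt d} (hE : Orthonormal ℝ E)
    {p : Fin m → ℝ} {w r : ℝ} {x y : Pt d} (hy : y ∈ slab E p w) (hxy : ‖x - y‖ ≤ r) :
    x ∈ slab E p (w + r) := by
  intro j
  have h1 := hy j
  have h2 := (abs_real_inner_le_norm (E j) (x - y)).trans_eq (by rw [hE.1, one_mul])
  rw [inner_sub_right] at h2
  rw [abs_le] at *
  constructor <;> linarith

open Classical in
/-- The indices in `S` of the closed cells which meet `T`. -/
def meeting {d : ℕ} (n : ℕ) (S : Finset (Fin d → ℤ)) (T : Set (Pt d)) : Finset (Fin d → ℤ) :=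
  S.filter fun z => (closedCell n z ∩ T).Nonempty

lemma card_meeting_le {d m n : ℕ} (hd : 0 < d) {S : Finset (Fin d → ℤ)} {M : ℝ}
    (hS : ∀ z ∈ S, IsUnitIndex n z) (hM : IsSpread m n S M) {E : Fin m → Pt d}
    (hE : Orthonormal ℝ E) (p : Fin m → ℝ) {w : ℝ} (hw : 0 < w) :
    ((meeting n S (slab E p w)).card : ℝ) ≤ M * S.card * (w + cellRadius d * (2 ^ n)⁻¹) ^ m := by
  have hR := cellRadius_nonneg d
  refine le_trans ?_ (hM E p (w + cellRadius d * (2 ^ n)⁻¹) hE (by positivity))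
  rw [← volume_cellUnion hd n]
  gcongr
  · exact ne_top_of_le_ne_top (volume_cellUnion_lt_top hd n S).ne (measure_mono inter_subset_left)
  · intro x hx
    simp only [cellUnion, mem_iUnion, exists_prop, meeting, Finset.mem_filter] at hx
    obtain ⟨z, ⟨hz, y, hy, hy'⟩, hx⟩ := hx
    refine ⟨mem_biUnion (x := z) hz hx, mem_slab_of_norm_sub_le hE hy' ?_⟩
    exact norm_sub_le_of_mem_closedCell hd (hS z hz) (cell_subset_closedCell n z hx) hy

lemma volume_cell_inter_slab_le {d m k n : ℕ} (hdmk : d = m + k) (hd : 0 < d) {z : Fin d → ℤ}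
    (hz : IsUnitIndex n z) {E : Fin m → Pt d} (hE : Orthonormal ℝ E) (p : Fin m → ℝ) {w : ℝ}
    (hw : 0 < w) :
    2 ^ (n * d) * volume.real (cell n z ∩ slab E p w) ≤
      w ^ m * ((2 * cellRadius d) ^ d / max w (cellRadius d * (2 ^ n)⁻¹) ^ m) := by
  set R := cellRadius d with hR
  have hR1 : 1 ≤ R := one_le_cellRadius hd
  set D := R * (2 ^ n)⁻¹ with hD
  have hD0 : 0 < D := by positivity
  rcases le_total w D with hwD | hwD
  · rw [max_eq_right hwD]
    have h1 : volume.real (cell n z ∩ slab E p w) ≤ (2 * w) ^ m * (2 * D) ^ k := by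
      rcases (cell n z).eq_empty_or_nonempty with h0 | ⟨x₀, hx₀⟩
      · rw [h0]; simp; positivity
      · refine ENNReal.toReal_le_of_le_ofReal (by positivity)
          (volume_inter_slab_le hdmk hE p hw.le hD0.le (x₀ := x₀) fun x hx => ?_)
        exact norm_sub_le_of_mem_closedCell hd hz (cell_subset_closedCell n z hx)
          (cell_subset_closedCell n z hx₀)
    calc 2 ^ (n * d) * volume.real (cell n z ∩ slab E p w)
        ≤ 2 ^ (n * d) * ((2 * w) ^ m * (2 * D) ^ k) := by gcongr
      _ = w ^ m * ((2 * R) ^ d / D ^ m) := by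
        rw [hdmk, hD, pow_mul, pow_add, pow_add, mul_pow, mul_pow, mul_pow, mul_pow, mul_pow]
        field_simp
        rw [div_pow, div_pow, one_pow]
        field_simp
  · rw [max_eq_left hwD, mul_div_cancel₀ _ (by positivity)]
    have h1 : volume.real (cell n z ∩ slab E p w) ≤ volume.real (cell n z) :=
      measureReal_mono inter_subset_left (volume_cell_lt_top hd n z).ne
    rw [volume_cell hd] at h1
    calc 2 ^ (n * d) * volume.real (cell n z ∩ slab E p w)
        ≤ 2 ^ (n * d) * (2 ^ (n * d))⁻¹ := by gcongr
      _ = 1 := mul_inv_cancel₀ (by positivity)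
      _ ≤ _ := one_le_pow₀ (by linarith)

lemma volume_cellUnion_image_inter {d : ℕ} (hd : 0 < d) (n : ℕ) (S : Finset (Fin d → ℤ))
    (c : (Fin d → ℤ) → Fin d → Fin 2) {T : Set (Pt d)} (hT : MeasurableSet T) :
    volume.real (cellUnion (n + 1) (S.image fun z => child z (c z)) ∩ T) =
      ∑ z ∈ S, volume.real (cell (n + 1) (child z (c z)) ∩ T) := by
  rw [sum_volume_cell_inter hd _ _ hT, Finset.sum_image]
  intro z _ z' _ h
  simpa using congrArg parent h

lemma card_image_child {d : ℕ} (S : Finset (Fin d → ℤ)) (c : (Fin d → ℤ) → Fin d → Fin 2) :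
    (S.image fun z => child z (c z)).card = S.card :=
  Finset.card_image_of_injOn fun z _ z' _ h => by simpa using congrArg parent h

/-- A spread set has a spread selection of children. -/
lemma exists_isSpread_image_child {d m k : ℕ} (hdmk : d = m + k) (hk : 1 ≤ k) :
    ∃ C : ℝ, 0 ≤ C ∧ ∀ (n : ℕ) (S : Finset (Fin d → ℤ)) (M : ℝ), S.Nonempty →
      (∀ z ∈ S, IsUnitIndex n z) → 1 ≤ M → IsSpread m n S M →
      ∃ c : (Fin d → ℤ) → Fin d → Fin 2,
        IsSpread m (n + 1) (S.image fun z => child z (c z))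
          (M * Real.exp (C * ((2 ^ n)⁻¹ + √((n + 1) * 2 ^ (n * m) / S.card)))) := by
  classical
  have hd : 0 < d := by omega
  obtain ⟨C₁, hC₁, hnet⟩ := exists_net_isSpread hdmk hk
  set R := cellRadius d with hR
  have hR1 : 1 ≤ R := one_le_cellRadius hd
  set C₂ : ℝ := (2 * R) ^ d with hC₂
  set C₃ : ℝ := 3 ^ m * C₂ ^ 2 * 2 ^ m with hC₃
  have hC₂0 : 0 ≤ C₂ := by positivity
  have hC₃0 : 0 ≤ C₃ := by positivity
  refine ⟨2 * C₁ + 4 * C₃, by positivity, fun n S M hSne hS hM hspread => ?_⟩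
  obtain ⟨P, hP, hcard, htest⟩ := hnet (n + 1)
  have hN : (0 : ℝ) < S.card := by exact_mod_cast hSne.card_pos
  set N : ℝ := (S.card : ℝ) with hNdef
  set a : ℝ := 2 ^ (n * m) / N with ha
  have ha0 : 0 < a := by positivity
  set s : ℝ := √((n + 1) / a) with hs
  have hs0 : 0 < s := Real.sqrt_pos.2 (by positivity)
  set D := R * (2 ^ (n + 1))⁻¹ with hD
  have hD0 : 0 < D := by positivity
  let f : (Fin m → Pt d) × (Fin m → ℝ) × ℝ → S → (Fin d → Fin 2) → ℝ := fun θ z c =>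
    2 ^ ((n + 1) * d) * volume.real (cell (n + 1) (child z.1 c) ∩ slab θ.1 θ.2.1 θ.2.2) /
      (θ.2.2 ^ m * N)
  let g : (Fin m → Pt d) × (Fin m → ℝ) × ℝ → S → ℝ := fun θ z =>
    2 ^ (n * d) * volume.real (cell n z.1 ∩ slab θ.1 θ.2.1 θ.2.2) / (θ.2.2 ^ m * N)
  let q : (Fin m → Pt d) × (Fin m → ℝ) × ℝ → S → ℝ := fun θ z =>
    if z.1 ∈ meeting n S (slab θ.1 θ.2.1 θ.2.2) then C₂ / max θ.2.2 D ^ m / N else 0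
  have hchoice : ∃ c : S → Fin d → Fin 2, ∀ θ ∈ P, ∑ i, f θ i (c i) ≤
      ∑ i, g θ i + C₁ * ((n + 1 : ℕ) + 1) / s + 4 * s * (M * C₃ * a) := by
    refine exists_choice_sum_le P f q g hs0 ?_ ?_ ?_ hcard
    · rintro θ hθ ⟨z, hz⟩ c
      obtain ⟨hE, hw⟩ := hP θ hθ
      simp only [f, q]
      rw [abs_of_nonneg (by positivity)]
      split_ifs with hmeet
      · have h1 := volume_cell_inter_slab_le hdmk hd (isUnitIndex_child (hS z hz) c) hE θ.2.1 hw
        rw [← hR, ← hD, ← hC₂] at h1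
        rw [div_le_iff₀ (by positivity)]
        refine h1.trans_eq ?_
        have : 0 < max θ.2.2 D := lt_max_of_lt_right hD0
        generalize max θ.2.2 D = u at this
        field_simp
      · have : cell (n + 1) (child z c) ∩ slab θ.1 θ.2.1 θ.2.2 = ∅ := by
          refine eq_empty_of_forall_notMem fun x hx => hmeet ?_
          simp only [meeting, Finset.mem_filter]
          refine ⟨hz, x, cell_subset_closedCell n z ?_, hx.2⟩
          simpa using cell_subset_cell_parent n _ hx.1
        rw [this]
        simp
    · rintro θ hθ ⟨z, hz⟩
      simp only [f, g]
      rw [← Finset.sum_div, ← Finset.mul_sum,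
        sum_volume_child_inter hd n z (isClosed_slab θ.1 θ.2.1 θ.2.2).measurableSet]
      rw [add_mul, one_mul, pow_add]
      simp
      ring
    · intro θ hθ
      obtain ⟨hE, hw⟩ := hP θ hθ
      set u := max θ.2.2 D with hu
      have hu0 : 0 < u := lt_max_of_lt_right hD0
      have h1 : ∑ z, q θ z ^ 2 = (meeting n S (slab θ.1 θ.2.1 θ.2.2)).card * (C₂ / u ^ m / N) ^ 2 := by
        rw [Finset.sum_coe_sort S fun z => (if z ∈ meeting n S (slab θ.1 θ.2.1 θ.2.2) then
          C₂ / u ^ m / N else 0) ^ 2]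
        simp only [ite_pow, zero_pow two_ne_zero]
        rw [← Finset.sum_filter, Finset.sum_const, nsmul_eq_mul]
        congr 3
        ext z
        simp only [meeting, Finset.mem_filter]
        tauto
      have h2 : ((meeting n S (slab θ.1 θ.2.1 θ.2.2)).card : ℝ) ≤ M * N * (3 * u) ^ m := by
        refine (card_meeting_le hd hS hspread hE _ hw).trans ?_
        gcongr
        have e1 : R * (2 ^ n)⁻¹ = 2 * D := by rw [hD, pow_succ]; field_simp
        rw [← hR, e1]
        have := le_max_left θ.2.2 D
        have := le_max_right θ.2.2 D
        linarith
      have h3 : (u ^ m)⁻¹ ≤ 2 ^ m * 2 ^ (n * m) := by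
        have e1 : (2 ^ (n + 1))⁻¹ ≤ u := by
          refine le_trans ?_ (le_max_right _ _)
          exact le_mul_of_one_le_left (by positivity) hR1
        have e2 : ((2 ^ (n + 1))⁻¹ : ℝ) ^ m ≤ u ^ m := by gcongr
        have e3 : (u ^ m)⁻¹ ≤ (((2 ^ (n + 1))⁻¹ : ℝ) ^ m)⁻¹ := by gcongr
        refine e3.trans_eq ?_
        rw [inv_pow, inv_inv, pow_mul, ← mul_pow, pow_succ, mul_comm]
      rw [h1]
      calc ((meeting n S (slab θ.1 θ.2.1 θ.2.2)).card : ℝ) * (C₂ / u ^ m / N) ^ 2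
          ≤ M * N * (3 * u) ^ m * (C₂ / u ^ m / N) ^ 2 := by gcongr
        _ = M * 3 ^ m * C₂ ^ 2 / N * (u ^ m)⁻¹ := by
          rw [mul_pow]
          field_simp
        _ ≤ M * 3 ^ m * C₂ ^ 2 / N * (2 ^ m * 2 ^ (n * m)) := by gcongr
        _ = M * C₃ * a := by
          rw [hC₃, ha]
          ring
  obtain ⟨c, hc⟩ := hchoice
  set B := M * (1 + (2 * C₁ + 4 * C₃) * √((n + 1) * a)) with hB
  have hB1 : 1 ≤ B := one_le_mul_of_one_le_of_one_le hM (by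
    have : 0 ≤ (2 * C₁ + 4 * C₃) * √((n + 1) * a) := by positivity
    linarith)
  set c' : (Fin d → ℤ) → Fin d → Fin 2 := fun z => if hz : z ∈ S then c ⟨z, hz⟩ else 0 with hc'
  have hunit : ∀ z ∈ S.image fun z => child z (c' z), IsUnitIndex (n + 1) z := by
    intro z hz
    obtain ⟨y, hy, rfl⟩ := Finset.mem_image.1 hz
    exact isUnitIndex_child (hS y hy) _
  refine ⟨c', fun E p w hE hw => ?_⟩
  refine (htest (S.image fun z => child z (c' z)) B hunit hB1 ?_ E p w hE hw).trans ?_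
  · intro θ hθ
    obtain ⟨hE, hw⟩ := hP θ hθ
    have hmeas := (isClosed_slab θ.1 θ.2.1 θ.2.2).measurableSet
    have h1 := hc θ hθ
    have h2 : ∑ z, f θ z (c z) = 2 ^ ((n + 1) * d) * volume.real (cellUnion (n + 1)
        (S.image fun z => child z (c' z)) ∩ slab θ.1 θ.2.1 θ.2.2) / (θ.2.2 ^ m * N) := by
      rw [volume_cellUnion_image_inter hd n S c' hmeas, Finset.mul_sum, Finset.sum_div,
        ← Finset.sum_coe_sort S]
      refine Finset.sum_congr rfl fun z _ => ?_
      simp only [f, hc', dif_pos z.2]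
    have h3 : ∑ z, g θ z ≤ M := by
      have : ∑ z, g θ z = 2 ^ (n * d) * volume.real (cellUnion n S ∩ slab θ.1 θ.2.1 θ.2.2) /
          (θ.2.2 ^ m * N) := by
        rw [sum_volume_cell_inter hd n S hmeas, Finset.mul_sum, Finset.sum_div,
          ← Finset.sum_coe_sort S]
      rw [this, div_le_iff₀ (by positivity)]
      exact (hspread _ _ _ hE hw).trans_eq (by ring)
    have h4 : C₁ * ((n + 1 : ℕ) + 1) / s ≤ M * (2 * C₁ * √((n + 1) * a)) := by
      have e1 : ((n : ℝ) + 1) / s = √((n + 1) * a) := by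
        rw [hs, div_eq_iff (Real.sqrt_ne_zero'.2 (by positivity)),
          ← Real.sqrt_mul (by positivity)]
        rw [show ((n : ℝ) + 1) * a * ((n + 1) / a) = (n + 1) ^ 2 by field_simp,
          Real.sqrt_sq (by positivity)]
      have e2 : C₁ * ((n + 1 : ℕ) + 1) / s ≤ C₁ * (2 * (n + 1)) / s := by
        gcongr
        push_cast
        linarith [(Nat.cast_nonneg n : (0 : ℝ) ≤ n)]
      have e3 : C₁ * (2 * (n + 1)) / s = 2 * C₁ * √((n + 1) * a) := by rw [← e1]; ring
      rw [e3] at e2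
      exact e2.trans (le_mul_of_one_le_left (by positivity) hM)
    have h5 : s * a = √((n + 1) * a) := by
      have e1 : √(a ^ 2) = a := Real.sqrt_sq ha0.le
      rw [hs]
      nth_rw 2 [← e1]
      rw [← Real.sqrt_mul (by positivity)]
      congr 1
      field_simp
    have h6 : 4 * s * (M * C₃ * a) = M * (4 * C₃ * √((n + 1) * a)) := by rw [← h5]; ring
    rw [h2, h6] at h1
    have h7 : 2 ^ ((n + 1) * d) * volume.real (cellUnion (n + 1)
        (S.image fun z => child z (c' z)) ∩ slab θ.1 θ.2.1 θ.2.2) / (θ.2.2 ^ m * N) ≤ B := by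
      refine h1.trans ?_
      rw [hB]
      linarith
    rw [div_le_iff₀ (by positivity)] at h7
    unfold DensityLE
    rw [card_image_child]
    exact h7.trans_eq (by ring)
  · rw [card_image_child]
    refine mul_le_mul_of_nonneg_right (mul_le_mul_of_nonneg_right ?_ (by positivity))
      (by positivity)
    rw [hB, mul_add (2 * C₁ + 4 * C₃), Real.exp_add]
    have e1 : (n + 1) * 2 ^ (n * m) / N = (n + 1) * a := by rw [ha]; ring
    rw [e1]
    have e2 := Real.add_one_le_exp ((2 * C₁ + 4 * C₃) * √((n + 1) * a))
    have e3 := Real.add_one_le_exp ((2 * C₁ + 4 * C₃) * (2 ^ n)⁻¹)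
    have e4 : 1 + C₁ * (2 ^ (n + 1))⁻¹ ≤ 1 + (2 * C₁ + 4 * C₃) * (2 ^ n)⁻¹ := by
      have : ((2 : ℝ) ^ (n + 1))⁻¹ ≤ (2 ^ n)⁻¹ := by
        gcongr
        · norm_num
        · omega
      gcongr
      linarith
    calc (1 + C₁ * (2 ^ (n + 1))⁻¹) * (M * (1 + (2 * C₁ + 4 * C₃) * √((n + 1) * a)))
        = M * ((1 + C₁ * (2 ^ (n + 1))⁻¹) * (1 + (2 * C₁ + 4 * C₃) * √((n + 1) * a))) := by ring
      _ ≤ _ := by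
        gcongr
        · linarith
        · linarith

lemma isUnitIndex_zero {d : ℕ} : IsUnitIndex 0 (0 : Fin d → ℤ) := by
  intro i
  simp

lemma isUnitIndex_of_parent {d n : ℕ} {z : Fin d → ℤ} (hz : IsUnitIndex n (parent z)) :
    IsUnitIndex (n + 1) z := by
  obtain ⟨c, hc⟩ := exists_child_parent z
  rw [← hc]
  exact isUnitIndex_child hz c

lemma exists_isSpread_zero {d m k : ℕ} (hdmk : d = m + k) (hd : 0 < d) :
    ∃ M : ℝ, 1 ≤ M ∧ IsSpread m 0 ({0} : Finset (Fin d → ℤ)) M := by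
  set R := cellRadius d with hR
  have hR1 : 1 ≤ R := one_le_cellRadius hd
  refine ⟨2 ^ m * (2 * R) ^ k, ?_, fun E p w hE hw => ?_⟩
  · exact one_le_mul_of_one_le_of_one_le (one_le_pow₀ (by norm_num)) (one_le_pow₀ (by linarith))
  · have h1 : volume.real (cellUnion 0 ({0} : Finset (Fin d → ℤ)) ∩ slab E p w) ≤
        (2 * w) ^ m * (2 * R) ^ k := by
      refine ENNReal.toReal_le_of_le_ofReal (by positivity)
        (volume_inter_slab_le hdmk hE p hw.le (by positivity) (x₀ := 0) fun x hx => ?_)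
      rw [sub_zero]
      exact norm_le_of_mem_cellUnion hd (by simpa using isUnitIndex_zero) hx
    unfold DensityLE
    simp only [zero_mul, pow_zero, one_mul, Finset.card_singleton, Nat.cast_one, mul_one]
    exact h1.trans_eq (by ring)

/-- A nested sequence of spread sets of cells with prescribed cardinalities. -/
lemma exists_spread_sequence {d m k : ℕ} (hdmk : d = m + k) (hk : 1 ≤ k) (H : ℕ → ℝ)
    (hpos : ∀ n, 0 < H n) (hmono : ∀ n, H (n + 1) ≤ H n) (hdoub : ∀ n, H n ≤ 2 ^ d * H (n + 1))
    (hsum : Summable fun n : ℕ => √((n + 1) * 2 ^ (n * m) * H n)) :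
    ∃ (S : ℕ → Finset (Fin d → ℤ)) (M : ℝ), S 0 = {0} ∧ 1 ≤ M ∧
      (∀ n, ∀ z ∈ S n, IsUnitIndex n z) ∧ (∀ n, ∀ z ∈ S (n + 1), parent z ∈ S n) ∧
      (∀ n, ∀ z ∈ S n, ((S (n + 1)).filter fun z' => parent z' = z).card * (S n).card =
        (S (n + 1)).card) ∧
      (∀ n, IsSpread m n (S n) M) ∧
      ∀ n, H 0 / 2 ^ d ≤ (S n).card * H n ∧ (S n).card * H n ≤ 2 ^ d * H 0 := by
  have hd : 0 < d := by omega
  have hH0 := hpos 0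
  obtain ⟨M₀, hM₀, hbase⟩ := exists_isSpread_zero hdmk hd
  obtain ⟨C, hC, hsel⟩ := exists_isSpread_image_child hdmk hk
  let κ : ℕ → ℝ := fun n =>
    C * ((2 ^ n)⁻¹ + √((H 0 / 2 ^ d)⁻¹) * √((n + 1) * 2 ^ (n * m) * H n))
  have hκ0 : ∀ n, 0 ≤ κ n := fun n => by positivity
  have hκ : Summable κ := by
    refine Summable.mul_left C (Summable.add ?_ (hsum.mul_left _))
    simpa only [inv_pow] using summable_geometric_of_lt_one (r := (2 : ℝ)⁻¹) (by norm_num) (by norm_num)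
  let B : ℕ → ℝ := fun n => M₀ * Real.exp (∑ i ∈ Finset.range n, κ i)
  have hB1 : ∀ n, 1 ≤ B n := fun n =>
    one_le_mul_of_one_le_of_one_le hM₀ (Real.one_le_exp (Finset.sum_nonneg fun i _ => hκ0 i))
  let Good : ℕ → Finset (Fin d → ℤ) → Prop := fun n S => (∀ z ∈ S, IsUnitIndex n z) ∧
    IsSpread m n S (B n) ∧ H 0 / 2 ^ d ≤ S.card * H n ∧ S.card * H n ≤ 2 ^ d * H 0
  let Next : Finset (Fin d → ℤ) → Finset (Fin d → ℤ) → Prop := fun S S' =>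
    (∀ z ∈ S', parent z ∈ S) ∧
    ∀ z ∈ S, (S'.filter fun z' => parent z' = z).card * S.card = S'.card
  have hstep : ∀ n S, Good n S → ∃ S', Good (n + 1) S' ∧ Next S S' := by
    rintro n S ⟨hS, hspread, hlow, hup⟩
    have hN : (0 : ℝ) < S.card := by
      by_contra hcon
      have := mul_nonpos_of_nonpos_of_nonneg (not_lt.1 hcon) (hpos n).le
      have : 0 < H 0 / 2 ^ d := by positivity
      linarith
    have hSne : S.Nonempty := Finset.card_pos.1 (by exact_mod_cast hN)
    have hBsucc : B (n + 1) = B n * Real.exp (κ n) := by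
      simp only [B]
      rw [Finset.sum_range_succ, Real.exp_add, mul_assoc]
    have hmonoM : ∀ S' : Finset (Fin d → ℤ), ∀ M', M' ≤ B (n + 1) → IsSpread m (n + 1) S' M' →
        IsSpread m (n + 1) S' (B (n + 1)) := fun S' M' hM' h E p w hE hw =>
      (h E p w hE hw).trans (by gcongr)
    rcases le_or_gt (S.card * H n) (H 0) with hc | hc
    · have hcard : ((allChildren S).card : ℝ) = 2 ^ d * S.card := by
        rw [card_allChildren]; push_cast; ring
      refine ⟨allChildren S, ⟨fun z hz => ?_, hmonoM _ (B n) ?_ hspread.allChildren, ?_, ?_⟩,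
        fun z hz => mem_allChildren.1 hz, fun z hz => ?_⟩
      · exact isUnitIndex_of_parent (hS _ (mem_allChildren.1 hz))
      · rw [hBsucc]
        exact le_mul_of_one_le_right (by linarith [hB1 n]) (Real.one_le_exp (hκ0 n))
      · rw [hcard]
        refine hlow.trans ?_
        calc S.card * H n ≤ S.card * (2 ^ d * H (n + 1)) := by gcongr; exact hdoub n
          _ = _ := by ring
      · rw [hcard]
        calc 2 ^ d * S.card * H (n + 1) ≤ 2 ^ d * S.card * H n := by gcongr; exact hmono n
          _ = 2 ^ d * (S.card * H n) := by ring
          _ ≤ _ := by gcongr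
      · rw [card_filter_parent_allChildren hz, card_allChildren]
    · obtain ⟨c, hc'⟩ := hsel n S (B n) hSne hS (hB1 n) hspread
      refine ⟨S.image fun z => child z (c z), ⟨fun z hz => ?_, hmonoM _ _ ?_ hc', ?_, ?_⟩,
        fun z hz => ?_, fun z hz => ?_⟩
      · obtain ⟨y, hy, rfl⟩ := Finset.mem_image.1 hz
        exact isUnitIndex_child (hS y hy) _
      · rw [hBsucc]
        have h1 : 2 ^ d / H 0 * (S.card * H n) ≥ 1 := by
          have := mul_le_mul_of_nonneg_left hlow (a := 2 ^ d / H 0) (by positivity)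
          refine le_trans (le_of_eq ?_) this
          field_simp
        have h2 : √((n + 1) * 2 ^ (n * m) / S.card) ≤
            √((H 0 / 2 ^ d)⁻¹) * √((n + 1) * 2 ^ (n * m) * H n) := by
          rw [← Real.sqrt_mul (by positivity)]
          refine Real.sqrt_le_sqrt ?_
          rw [div_le_iff₀ hN, inv_div]
          calc ((n : ℝ) + 1) * 2 ^ (n * m) ≤ ((n : ℝ) + 1) * 2 ^ (n * m) *
                (2 ^ d / H 0 * (S.card * H n)) := le_mul_of_one_le_right (by positivity) h1
            _ = _ := by ring
        have := hB1 n
        refine mul_le_mul_of_nonneg_left (Real.exp_le_exp.2 ?_) (by linarith)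
        exact mul_le_mul_of_nonneg_left (add_le_add le_rfl h2) hC
      · rw [card_image_child, div_le_iff₀ (by positivity)]
        calc H 0 ≤ S.card * H n := hc.le
          _ ≤ S.card * (2 ^ d * H (n + 1)) := by gcongr; exact hdoub n
          _ = _ := by ring
      · rw [card_image_child]
        refine le_trans ?_ hup
        gcongr
        exact hmono n
      · obtain ⟨y, hy, rfl⟩ := Finset.mem_image.1 hz
        simpa using hy
      · rw [card_image_child]
        have : ((S.image fun z => child z (c z)).filter fun z' => parent z' = z) =
            {child z (c z)} := by
          ext y
          simp only [Finset.mem_filter, Finset.mem_image, Finset.mem_singleton]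
          constructor
          · rintro ⟨⟨x, hx, rfl⟩, h⟩
            rw [parent_child] at h
            rw [h]
          · rintro rfl
            exact ⟨⟨z, hz, rfl⟩, parent_child _ _⟩
        rw [this, Finset.card_singleton, one_mul]
  have hgood0 : Good 0 {0} := by
    refine ⟨by simpa using isUnitIndex_zero, by simpa [B] using hbase, ?_, ?_⟩
    · rw [Finset.card_singleton, Nat.cast_one, one_mul]
      exact div_le_self hH0.le (one_le_pow₀ (by norm_num))
    · rw [Finset.card_singleton, Nat.cast_one, one_mul]
      exact le_mul_of_one_le_left hH0.le (one_le_pow₀ (by norm_num))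
  choose next hnext hnext' using hstep
  let F : ∀ n, {S // Good n S} := fun n =>
    Nat.rec ⟨{0}, hgood0⟩ (fun n S => ⟨next n S.1 S.2, hnext n S.1 S.2⟩) n
  refine ⟨fun n => (F n).1, M₀ * Real.exp (∑' i, κ i), rfl, ?_, fun n => (F n).2.1,
    fun n => (hnext' n _ (F n).2).1, fun n => (hnext' n _ (F n).2).2, fun n E p w hE hw => ?_,
    fun n => (F n).2.2.2⟩
  · exact one_le_mul_of_one_le_of_one_le hM₀ (Real.one_le_exp (tsum_nonneg hκ0))
  · refine ((F n).2.2.1 E p w hE hw).trans ?_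
    have : B n ≤ M₀ * Real.exp (∑' i, κ i) := by
      refine mul_le_mul_of_nonneg_left (Real.exp_le_exp.2 ?_) (by linarith)
      exact hκ.sum_le_tsum _ fun i _ => hκ0 i
    gcongr

lemma closedCell_subset_closedCell_parent {d : ℕ} (n : ℕ) (z : Fin d → ℤ) :
    closedCell (n + 1) z ⊆ closedCell n (parent z) := by
  intro x hx i
  obtain ⟨h1, h2⟩ := hx i
  have h3 : 2 * parent z i ≤ z i := by simp only [parent]; omega
  have h4 : z i + 1 ≤ 2 * (parent z i + 1) := by simp only [parent]; omega
  have h5 : 2 * (parent z i : ℝ) ≤ z i := by exact_mod_cast h3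
  have h6 : (z i : ℝ) + 1 ≤ 2 * (parent z i + 1) := by exact_mod_cast h4
  rw [pow_succ] at h1 h2
  constructor <;> nlinarith

lemma closedCell_subset_closedCell_iterate {d : ℕ} (n i : ℕ) (z : Fin d → ℤ) :
    closedCell (n + i) z ⊆ closedCell n (parent^[i] z) := by
  induction i generalizing z with
  | zero => exact subset_rfl
  | succ i ih => exact (closedCell_subset_closedCell_parent (n + i) z).trans (ih (parent z))

lemma nonempty_closedCell {d : ℕ} (hd : 0 < d) (n : ℕ) (z : Fin d → ℤ) :
    (closedCell n z).Nonempty := by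
  refine Nonempty.mono (cell_subset_closedCell n z) ?_
  by_contra hcon
  have := volume_cell hd n z
  rw [not_nonempty_iff_eq_empty.1 hcon, measureReal_empty] at this
  exact (inv_pos.2 (by positivity : (0 : ℝ) < 2 ^ (n * d))).ne this

lemma isCompact_closedCell {d n : ℕ} (hd : 0 < d) {z : Fin d → ℤ} (hz : IsUnitIndex n z) :
    IsCompact (closedCell n z) := by
  refine isCompact_of_isClosed_isBounded (isClosed_closedCell n z) ?_
  refine isBounded_iff_forall_norm_le.2 ⟨cellRadius d, fun x hx => norm_le_cellRadius hd hz hx⟩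

lemma mem_meeting {d n : ℕ} {S : Finset (Fin d → ℤ)} {T : Set (Pt d)} {z : Fin d → ℤ} :
    z ∈ meeting n S T ↔ z ∈ S ∧ (closedCell n z ∩ T).Nonempty := by
  simp only [meeting, Finset.mem_filter]

/-- A sequence of sets of cells which forms a homogeneous tree. -/
structure IsCellTree {d : ℕ} (S : ℕ → Finset (Fin d → ℤ)) : Prop where
  zero : S 0 = {0}
  isUnitIndex : ∀ n, ∀ z ∈ S n, IsUnitIndex n z
  parent_mem : ∀ n, ∀ z ∈ S (n + 1), parent z ∈ S n
  card_children : ∀ n, ∀ z ∈ S n,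
    ((S (n + 1)).filter fun z' => parent z' = z).card * (S n).card = (S (n + 1)).card
  card_pos : ∀ n, 0 < (S n).card

/-- The union of the closed cells of the given level with indices in `S`. -/
def closedUnion {d : ℕ} (n : ℕ) (S : Finset (Fin d → ℤ)) : Set (Pt d) := ⋃ z ∈ S, closedCell n z

/-- The limit set of a tree of cells. -/
def limitSet {d : ℕ} (S : ℕ → Finset (Fin d → ℤ)) : Set (Pt d) := ⋂ n, closedUnion n (S n)

/-- The elements of `S (j + i)` with ancestor in `T`. -/
def descendants {d : ℕ} (S : ℕ → Finset (Fin d → ℤ)) (j i : ℕ) (T : Finset (Fin d → ℤ)) :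
    Finset (Fin d → ℤ) :=
  (S (j + i)).filter fun z => parent^[i] z ∈ T

namespace IsCellTree

variable {d : ℕ} {S : ℕ → Finset (Fin d → ℤ)}

lemma iterate_parent_mem (hS : IsCellTree S) (j i : ℕ) {z : Fin d → ℤ} (hz : z ∈ S (j + i)) :
    parent^[i] z ∈ S j := by
  induction i generalizing z with
  | zero => exact hz
  | succ i ih => exact ih (hS.parent_mem _ z hz)

lemma card_descendants (hS : IsCellTree S) (j i : ℕ) {T : Finset (Fin d → ℤ)} (hT : T ⊆ S j) :
    (descendants S j i T).card * (S j).card = T.card * (S (j + i)).card := by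
  induction i with
  | zero =>
    have : descendants S j 0 T = T := by
      ext z
      simp only [descendants, Finset.mem_filter, Function.iterate_zero, id, add_zero]
      exact ⟨fun h => h.2, fun h => ⟨hT h, h⟩⟩
    rw [this, add_zero]
  | succ i ih =>
    have h1 : (descendants S j (i + 1) T).card * (S (j + i)).card =
        (descendants S j i T).card * (S (j + (i + 1))).card := by
      rw [Finset.card_eq_sum_card_fiberwise (f := parent) (t := descendants S j i T),
        Finset.sum_mul, Finset.sum_congr rfl, Finset.sum_const, smul_eq_mul]
      · intro z hz
        rw [← add_assoc, ← hS.card_children (j + i) z (Finset.mem_filter.1 hz).1]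
        congr 2
        ext z'
        simp only [descendants, Finset.mem_filter, Function.iterate_succ_apply, ← add_assoc]
        constructor
        · tauto
        · rintro ⟨h, rfl⟩
          exact ⟨⟨h, (Finset.mem_filter.1 hz).2⟩, rfl⟩
      · intro z hz
        simp only [descendants, Finset.coe_filter, mem_ofPred_eq, Function.iterate_succ_apply,
          ← add_assoc] at hz ⊢
        exact ⟨hS.parent_mem _ z hz.1, hz.2⟩
    refine Nat.eq_of_mul_eq_mul_right (hS.card_pos (j + i)) ?_
    calc (descendants S j (i + 1) T).card * (S j).card * (S (j + i)).card
        = (descendants S j (i + 1) T).card * (S (j + i)).card * (S j).card := by ring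
      _ = ((descendants S j i T).card * (S j).card) * (S (j + (i + 1))).card := by rw [h1]; ring
      _ = _ := by rw [ih]; ring

lemma isCompact_closedUnion (hS : IsCellTree S) (hd : 0 < d) (n : ℕ) :
    IsCompact (closedUnion n (S n)) :=
  (S n).isCompact_biUnion fun z hz => isCompact_closedCell hd (hS.isUnitIndex n z hz)

lemma isCompact_limitSet (hS : IsCellTree S) (hd : 0 < d) : IsCompact (limitSet S) :=
  (hS.isCompact_closedUnion hd 0).of_isClosed_subset
    (isClosed_iInter fun n => (hS.isCompact_closedUnion hd n).isClosed) (iInter_subset _ 0)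

lemma antitone_closedUnion (hS : IsCellTree S) : Antitone fun n => closedUnion n (S n) := by
  refine antitone_nat_of_succ_le fun n x hx => ?_
  simp only [closedUnion, mem_iUnion] at hx ⊢
  obtain ⟨z, hz, hx⟩ := hx
  exact ⟨parent z, hS.parent_mem n z hz, closedCell_subset_closedCell_parent n z hx⟩

lemma mem_closedUnion_descendants (hS : IsCellTree S) (j i : ℕ) {T : Set (Pt d)} {x : Pt d}
    (hx : x ∈ closedUnion (j + i) (S (j + i))) (hxT : x ∈ T) :
    x ∈ closedUnion (j + i) (descendants S j i (meeting j (S j) T)) := by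
  simp only [closedUnion, mem_iUnion] at hx ⊢
  obtain ⟨z, hz, hx⟩ := hx
  exact ⟨z, Finset.mem_filter.2 ⟨hz, mem_meeting.2 ⟨hS.iterate_parent_mem j i hz, x,
    closedCell_subset_closedCell_iterate j i z hx, hxT⟩⟩, hx⟩

lemma norm_le_of_mem_limitSet (hS : IsCellTree S) (hd : 0 < d) {x : Pt d} (hx : x ∈ limitSet S) :
    ‖x‖ ≤ cellRadius d := by
  have := mem_iInter.1 hx 0
  simp only [closedUnion, mem_iUnion] at this
  obtain ⟨z, hz, hx⟩ := this
  exact norm_le_cellRadius hd (hS.isUnitIndex 0 z hz) hx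

end IsCellTree

lemma card_meeting_le_of_norm_sub_le {d n : ℕ} (hd : 0 < d) {S : Finset (Fin d → ℤ)}
    (hS : ∀ z ∈ S, IsUnitIndex n z) {U : Set (Pt d)} {ρ : ℝ} (hρ : 0 ≤ ρ)
    (hU : ∀ x ∈ U, ∀ y ∈ U, ‖x - y‖ ≤ ρ * (2 ^ n)⁻¹) :
    ((meeting n S U).card : ℝ) ≤ (2 * (ρ + cellRadius d)) ^ d := by
  have hR := cellRadius_nonneg d
  rcases U.eq_empty_or_nonempty with rfl | ⟨x₀, hx₀⟩
  · have : meeting n S ∅ = ∅ := by simp [meeting]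
    rw [this]
    simp only [Finset.card_empty, Nat.cast_zero]
    positivity
  · have hE : Orthonormal ℝ (Fin.elim0 : Fin 0 → Pt d) := ⟨fun i => i.elim0, fun i => i.elim0⟩
    have h1 := volume_inter_slab_le (m := 0) (k := d) (by omega) hE Fin.elim0 le_rfl
      (r := (ρ + cellRadius d) * (2 ^ n)⁻¹) (by positivity) (x₀ := x₀)
      (G := cellUnion n (meeting n S U)) (fun x hx => by
        simp only [cellUnion, mem_iUnion, exists_prop, meeting, Finset.mem_filter] at hx
        obtain ⟨z, ⟨hz, y, hy, hyU⟩, hx⟩ := hx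
        have e1 := norm_sub_le_of_mem_closedCell hd (hS z hz) (cell_subset_closedCell n z hx) hy
        have e2 := hU y hyU x₀ hx₀
        have e3 := norm_sub_le_norm_sub_add_norm_sub x y x₀
        linarith)
    have h2 : slab (Fin.elim0 : Fin 0 → Pt d) Fin.elim0 0 = univ :=
      eq_univ_of_forall fun x i => i.elim0
    rw [h2, inter_univ] at h1
    have h3 := ENNReal.toReal_le_of_le_ofReal (by positivity) h1
    rw [← volume_cellUnion hd n]
    refine (mul_le_mul_of_nonneg_left h3 (by positivity)).trans_eq ?_
    rw [pow_zero, one_mul, ← mul_assoc, mul_pow, pow_mul, inv_pow]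
    field_simp

namespace IsCellTree

variable {d : ℕ} {S : ℕ → Finset (Fin d → ℤ)}

lemma card_descendants_eq_div (hS : IsCellTree S) (j i : ℕ) {T : Finset (Fin d → ℤ)}
    (hT : T ⊆ S j) : ((descendants S j i T).card : ℝ) =
      T.card * (S (j + i)).card / (S j).card := by
  rw [eq_div_iff (by exact_mod_cast (hS.card_pos j).ne')]
  exact_mod_cast hS.card_descendants j i hT

lemma meeting_subset (n : ℕ) (S : Finset (Fin d → ℤ)) (T : Set (Pt d)) : meeting n S T ⊆ S :=
  fun _ hz => (mem_meeting.1 hz).1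

lemma one_le_sum_of_subset_iUnion (hS : IsCellTree S) (hd : 0 < d) {U : ℕ → Set (Pt d)}
    (hUo : ∀ n, IsOpen (U n)) (hU : limitSet S ⊆ ⋃ n, U n) (j : ℕ → ℕ) {ρ : ℝ} (hρ : 0 ≤ ρ)
    (hdist : ∀ n, ∀ x ∈ U n, ∀ y ∈ U n, ‖x - y‖ ≤ ρ * (2 ^ j n)⁻¹) :
    ∃ F : Finset ℕ, 1 ≤ ∑ n ∈ F, (2 * (ρ + cellRadius d)) ^ d / (S (j n)).card := by
  classical
  obtain ⟨l₀, hl₀⟩ := exists_subset_nhds_of_isCompact hS.antitone_closedUnion.directed_ge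
    (fun n => hS.isCompact_closedUnion hd n) (U := ⋃ n, U n)
    fun x hx => (isOpen_iUnion hUo).mem_nhds (hU hx)
  obtain ⟨F, hF⟩ := (hS.isCompact_closedUnion hd l₀).elim_finite_subcover U hUo hl₀
  refine ⟨F, ?_⟩
  set l := max l₀ (F.sup j) with hl
  have hlN : (0 : ℝ) < (S l).card := by exact_mod_cast hS.card_pos l
  have hsub : S l ⊆ F.biUnion fun n =>
      descendants S (j n) (l - j n) (meeting (j n) (S (j n)) (U n)) := by
    intro z hz
    obtain ⟨x, hx⟩ := nonempty_closedCell hd l z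
    have hx' : x ∈ closedUnion l (S l) := mem_biUnion (x := z) hz hx
    have hx'' := hF (hS.antitone_closedUnion (le_max_left _ _) hx')
    simp only [mem_iUnion] at hx''
    obtain ⟨n, hn, hxn⟩ := hx''
    have hjl : j n + (l - j n) = l :=
      Nat.add_sub_cancel' ((Finset.le_sup hn).trans (le_max_right _ _))
    refine Finset.mem_biUnion.2 ⟨n, hn, Finset.mem_filter.2 ⟨by rwa [hjl], mem_meeting.2
      ⟨hS.iterate_parent_mem _ _ (by rwa [hjl]), x, closedCell_subset_closedCell_iterate _ _ z ?_,
        hxn⟩⟩⟩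
    rwa [hjl]
  have h1 : ((S l).card : ℝ) ≤
      ∑ n ∈ F, (2 * (ρ + cellRadius d)) ^ d / (S (j n)).card * (S l).card := by
    have h2 := (Finset.card_le_card hsub).trans Finset.card_biUnion_le
    calc ((S l).card : ℝ) ≤ ∑ n ∈ F,
          ((descendants S (j n) (l - j n) (meeting (j n) (S (j n)) (U n))).card : ℝ) := by
          exact_mod_cast h2
      _ ≤ _ := by
        refine Finset.sum_le_sum fun n hn => ?_
        have hjl : j n + (l - j n) = l :=
          Nat.add_sub_cancel' ((Finset.le_sup hn).trans (le_max_right _ _))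
        rw [hS.card_descendants_eq_div _ _ (meeting_subset _ _ _), hjl, mul_div_right_comm]
        have := card_meeting_le_of_norm_sub_le hd (hS.isUnitIndex (j n)) hρ (hdist n)
        gcongr
  rw [← Finset.sum_mul] at h1
  exact le_of_mul_le_mul_right (by rwa [one_mul]) hlN

end IsCellTree

/-- The properties of gauge functions which are used for the limit sets of trees of cells. -/
structure IsGauge (d : ℕ) (h : ℝ → ℝ) : Prop where
  pos : ∀ t, 0 < t → 0 < h t
  mono : ∀ s t, 0 < s → s ≤ t → h s ≤ h t
  tendsto : Filter.Tendsto h (nhdsWithin 0 (Set.Ioi 0)) (nhds 0)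
  doubling : ∀ t, 0 < t → h (2 * t) ≤ 2 ^ d * h t

lemma IsGauge.doubling_pow {d : ℕ} {h : ℝ → ℝ} (hh : IsGauge d h) (q : ℕ) {t : ℝ} (ht : 0 < t) :
    h (2 ^ q * t) ≤ 2 ^ (q * d) * h t := by
  induction q with
  | zero => simp
  | succ q ih =>
    calc h (2 ^ (q + 1) * t) = h (2 * (2 ^ q * t)) := by rw [pow_succ]; ring_nf
      _ ≤ 2 ^ d * h (2 ^ q * t) := hh.doubling _ (by positivity)
      _ ≤ 2 ^ d * (2 ^ (q * d) * h t) := by gcongr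
      _ = _ := by rw [add_mul, one_mul, pow_add]; ring

lemma IsGauge.tendsto_inv_pow {d : ℕ} {h : ℝ → ℝ} (hh : IsGauge d h) :
    Filter.Tendsto (fun n : ℕ => h ((2 ^ n)⁻¹)) Filter.atTop (nhds 0) := by
  refine hh.tendsto.comp (tendsto_nhdsWithin_iff.2 ⟨?_, Filter.Eventually.of_forall fun n => ?_⟩)
  · simpa only [inv_pow] using
      tendsto_pow_atTop_nhds_zero_of_lt_one (r := (2 : ℝ)⁻¹) (by norm_num) (by norm_num)
  · exact inv_pos.2 (by positivity : (0 : ℝ) < 2 ^ n)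

lemma IsCellTree.gMeasure_limitSet_pos {d : ℕ} {S : ℕ → Finset (Fin d → ℤ)} (hS : IsCellTree S)
    (hd : 0 < d) {h : ℝ → ℝ} (hh : IsGauge d h) {a : ℝ} (ha : 0 < a)
    (hlow : ∀ n, a ≤ (S n).card * h ((2 ^ n)⁻¹)) : 0 < gMeasure h (limitSet S) := by
  set G : ℝ := (2 * (3 + cellRadius d)) ^ d with hG
  have hR := cellRadius_nonneg d
  have hG0 : 0 < G := by positivity
  have hN : ∀ n, G / (S n).card ≤ G / a * h ((2 ^ n)⁻¹) := by
    intro n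
    have hc : (0 : ℝ) < (S n).card := by exact_mod_cast hS.card_pos n
    rw [div_le_iff₀ hc]
    calc G = G / a * a := by field_simp
      _ ≤ G / a * ((S n).card * h ((2 ^ n)⁻¹)) := by gcongr; exact hlow n
      _ = _ := by ring
  set K : ℝ := G / a * 2 ^ d with hK
  have hK0 : 0 < K := by positivity
  suffices ENNReal.ofReal ((2 * K)⁻¹) ≤ gMeasure h (limitSet S) from
    lt_of_lt_of_le (ENNReal.ofReal_pos.2 (by positivity)) this
  rw [gMeasure, Measure.mkMetric_apply]
  refine le_iSup₂_of_le 1 one_pos (le_iInf₂ fun t ht => le_iInf fun hdiam => ?_)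
  have hsmall : ∀ ε : ℝ, 0 < ε → ∃ j, G / (S j).card ≤ ε := by
    intro ε hε
    have := (hh.tendsto_inv_pow.const_mul (G / a)).eventually_le_const
      (u := ε) (by rwa [mul_zero])
    obtain ⟨j, hj⟩ := this.exists
    exact ⟨j, (hN j).trans hj⟩
  have hne : ∀ n, ediam (t n) ≠ ⊤ := fun n => ((hdiam n).trans_lt ENNReal.one_lt_top).ne
  have hbd : ∀ n, ∀ x ∈ t n, ∀ y ∈ t n, dist x y ≤ diam (t n) := fun n x hx y hy =>
    dist_le_diam_of_mem' (hne n) hx hy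
  have hkey : ∀ n, ∃ (j : ℕ) (ε : ℝ), 0 < ε ∧ diam (t n) + 2 * ε ≤ 3 * (2 ^ j)⁻¹ ∧
      ENNReal.ofReal (G / (S j).card) ≤ ENNReal.ofReal K *
        (⨆ _ : (t n).Nonempty, ENNReal.ofReal (h (ediam (t n)).toReal)) +
          ENNReal.ofReal ((1 / 2) ^ (n + 2)) := by
    intro n
    rcases (diam_nonneg (s := t n)).eq_or_lt with h0 | h0
    · obtain ⟨j, hj⟩ := hsmall ((1 / 2) ^ (n + 2)) (by positivity)
      refine ⟨j, (2 ^ j)⁻¹, by positivity, ?_, le_add_left (ENNReal.ofReal_le_ofReal hj)⟩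
      have : (0 : ℝ) < (2 ^ j)⁻¹ := by positivity
      linarith
    · have hle : diam (t n) ≤ 1 := by
        refine ENNReal.toReal_le_of_le_ofReal zero_le_one ?_
        simpa using hdiam n
      obtain ⟨j, hj1, hj2⟩ := exists_nat_pow_near_of_lt_one h0 hle
        (by norm_num : (0 : ℝ) < 1 / 2) (by norm_num)
      rw [one_div, inv_pow] at hj1 hj2
      refine ⟨j, diam (t n), h0, by linarith, ?_⟩
      have hne' : (t n).Nonempty := by
        by_contra hcon
        rw [not_nonempty_iff_eq_empty.1 hcon, diam_empty] at h0
        exact h0.false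
      refine le_add_right ?_
      rw [iSup_pos hne', ← ENNReal.ofReal_mul hK0.le]
      refine ENNReal.ofReal_le_ofReal ((hN j).trans ?_)
      rw [hK, mul_assoc]
      refine mul_le_mul_of_nonneg_left ?_ (by positivity)
      have e1 : ((2 : ℝ) ^ j)⁻¹ = 2 * (2 ^ (j + 1))⁻¹ := by rw [pow_succ]; field_simp
      rw [e1]
      refine (hh.doubling _ (by positivity)).trans ?_
      gcongr
      exact hh.mono _ _ (by positivity) hj1.le
  choose j ε hε hjε hcost using hkey
  obtain ⟨F, hF⟩ := hS.one_le_sum_of_subset_iUnion hd (U := fun n => thickening (ε n) (t n))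
    (fun n => isOpen_thickening)
    (ht.trans (iUnion_mono fun n => self_subset_thickening (hε n) _)) j (by norm_num : (0:ℝ) ≤ 3)
    (fun n x hx y hy => by
      obtain ⟨x', hx', hxx⟩ := mem_thickening_iff.1 hx
      obtain ⟨y', hy', hyy⟩ := mem_thickening_iff.1 hy
      rw [← dist_eq_norm]
      have e1 := dist_triangle4 x x' y' y
      have e2 := hbd n x' hx' y' hy'
      rw [dist_comm y y'] at hyy
      linarith [hjε n])
  rw [← hG] at hF
  set σ := ∑' n, ⨆ _ : (t n).Nonempty, ENNReal.ofReal (h (ediam (t n)).toReal) with hσ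
  have h1 : (1 : ℝ≥0∞) ≤ ENNReal.ofReal K * σ + ENNReal.ofReal (1 / 2) := by
    have hgeom : ∑' n : ℕ, ENNReal.ofReal ((1 / 2 : ℝ) ^ (n + 2)) = ENNReal.ofReal (1 / 2) := by
      rw [← ENNReal.ofReal_tsum_of_nonneg (fun n => by positivity)
        ((summable_nat_add_iff 2).2 summable_geometric_two)]
      congr 1
      simp_rw [pow_add]
      rw [tsum_mul_right, tsum_geometric_two]
      norm_num
    calc (1 : ℝ≥0∞) = ENNReal.ofReal 1 := ENNReal.ofReal_one.symm
      _ ≤ ENNReal.ofReal (∑ n ∈ F, G / (S (j n)).card) := ENNReal.ofReal_le_ofReal hF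
      _ = ∑ n ∈ F, ENNReal.ofReal (G / (S (j n)).card) :=
        ENNReal.ofReal_sum_of_nonneg fun n _ => by positivity
      _ ≤ ∑' n, ENNReal.ofReal (G / (S (j n)).card) := ENNReal.sum_le_tsum _
      _ ≤ ∑' n, (ENNReal.ofReal K *
        (⨆ _ : (t n).Nonempty, ENNReal.ofReal (h (ediam (t n)).toReal)) +
          ENNReal.ofReal ((1 / 2) ^ (n + 2))) := ENNReal.tsum_le_tsum hcost
      _ = _ := by rw [ENNReal.tsum_add, ENNReal.tsum_mul_left, hgeom]
  rcases eq_or_ne σ ⊤ with htop | htop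
  · rw [htop]
    exact le_top
  · rw [← ENNReal.ofReal_toReal htop] at h1 ⊢
    rw [← ENNReal.ofReal_mul hK0.le, ← ENNReal.ofReal_add (by positivity) (by norm_num),
      ENNReal.one_le_ofReal] at h1
    refine ENNReal.ofReal_le_ofReal ?_
    rw [inv_le_iff_one_le_mul₀ (by positivity)]
    linarith

lemma IsCellTree.gMeasure_limitSet_inter_le {d m : ℕ} {S : ℕ → Finset (Fin d → ℤ)}
    (hS : IsCellTree S) (hd : 0 < d) {h : ℝ → ℝ} (hh : IsGauge d h) {M b : ℝ} (hM : 0 ≤ M)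
    (hspread : ∀ n, IsSpread m n (S n) M) (hup : ∀ n, (S n).card * h ((2 ^ n)⁻¹) ≤ b) :
    ∃ C : ℝ, 0 ≤ C ∧ ∀ (E : Fin m → Pt d) (p : Fin m → ℝ) (w : ℝ), Orthonormal ℝ E → 0 < w →
      gMeasure h (limitSet S ∩ slab E p w) ≤ ENNReal.ofReal (C * w ^ m) := by
  have : Nonempty (Fin d) := ⟨⟨0, hd⟩⟩
  set R := cellRadius d with hR
  have hR1 : 1 ≤ R := one_le_cellRadius hd
  have hb0 : 0 ≤ b := by
    refine le_trans ?_ (hup 0)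
    have := (hh.pos ((2 ^ 0)⁻¹) (by norm_num)).le
    positivity
  obtain ⟨q, hq⟩ := pow_unbounded_of_one_lt (2 * R) (by norm_num : (1 : ℝ) < 2)
  refine ⟨M * (1 + R) ^ m * 2 ^ (q * d) * b, by positivity, fun E p w hE hw => ?_⟩
  obtain ⟨j, hj⟩ := exists_pow_lt_of_lt_one hw (by norm_num : (2 : ℝ)⁻¹ < 1)
  rw [inv_pow] at hj
  set T := meeting j (S j) (slab E p w) with hT
  have hTS : T ⊆ S j := meeting_subset _ _ _
  have hTcard : (T.card : ℝ) ≤ M * (S j).card * ((1 + R) * w) ^ m := by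
    refine (card_meeting_le hd (hS.isUnitIndex j) (hspread j) hE p hw).trans ?_
    rw [← hR]
    gcongr
    rw [add_mul, one_mul]
    gcongr
  choose x hx using nonempty_closedCell (d := d) hd
  have hr : ∀ l : ℕ, 0 < R * (2 ^ l)⁻¹ := fun l => by positivity
  have hbound : ∀ i, ∑ z : descendants S j i T, ENNReal.ofReal (h (ediam
      (closedBall (x (j + i) z) (R * (2 ^ (j + i))⁻¹))).toReal) ≤
        ENNReal.ofReal (M * (1 + R) ^ m * 2 ^ (q * d) * b * w ^ m) := by
    intro i
    set l := j + i with hl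
    have hhl := hh.pos ((2 ^ l)⁻¹) (by positivity)
    have hdiam : ∀ y : Pt d, (ediam (closedBall y (R * (2 ^ l)⁻¹))).toReal =
        2 * (R * (2 ^ l)⁻¹) := fun y => Metric.diam_closedBall_eq y (hr l).le
    simp only [hdiam, Finset.sum_const, Finset.card_univ, Fintype.card_coe]
    rw [← ENNReal.ofReal_nsmul, nsmul_eq_mul]
    refine ENNReal.ofReal_le_ofReal ?_
    have h1 : h (2 * (R * (2 ^ l)⁻¹)) ≤ 2 ^ (q * d) * h ((2 ^ l)⁻¹) := by
      refine le_trans (hh.mono _ _ (by positivity) ?_) (hh.doubling_pow q (by positivity))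
      rw [← mul_assoc]
      gcongr
    have h2 := (hh.pos (2 * (R * (2 ^ l)⁻¹)) (by positivity)).le
    have hNj : (0 : ℝ) < (S j).card := by exact_mod_cast hS.card_pos j
    rw [hS.card_descendants_eq_div j i hTS, ← hl]
    calc (T.card : ℝ) * (S l).card / (S j).card * h (2 * (R * (2 ^ l)⁻¹))
        ≤ (M * (S j).card * ((1 + R) * w) ^ m) * (S l).card / (S j).card *
          (2 ^ (q * d) * h ((2 ^ l)⁻¹)) := by gcongr
      _ = M * ((1 + R) * w) ^ m * 2 ^ (q * d) * ((S l).card * h ((2 ^ l)⁻¹)) := by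
        field_simp
      _ ≤ M * ((1 + R) * w) ^ m * 2 ^ (q * d) * b := by gcongr; exact hup l
      _ = _ := by rw [mul_pow]; ring
  have hlim : Filter.Tendsto (fun i : ℕ => ENNReal.ofReal (2 * (R * (2 ^ (j + i))⁻¹)))
      Filter.atTop (nhds 0) := by
    rw [← ENNReal.ofReal_zero]
    refine ENNReal.tendsto_ofReal ?_
    have h1 := tendsto_pow_atTop_nhds_zero_of_lt_one (r := (2 : ℝ)⁻¹) (by norm_num) (by norm_num)
    have h2 := h1.const_mul (2 * R * (2 ^ j)⁻¹)
    rw [mul_zero] at h2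
    refine h2.congr fun i => ?_
    rw [pow_add, mul_inv, inv_pow]
    ring
  refine (Measure.mkMetric_le_liminf_sum (ι := fun i : ℕ => descendants S j i T) _ _ hlim
    (fun i z => closedBall (x (j + i) z) (R * (2 ^ (j + i))⁻¹)) ?_ ?_ _).trans ?_
  · refine Filter.Eventually.of_forall fun i z => ?_
    rw [← Metric.diam_closedBall_eq (x (j + i) z) (hr _).le]
    exact (ENNReal.ofReal_toReal (isBounded_closedBall.ediam_ne_top)).ge
  · refine Filter.Eventually.of_forall fun i y hy => ?_
    have h1 := hS.mem_closedUnion_descendants j i (mem_iInter.1 hy.1 (j + i)) hy.2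
    simp only [closedUnion, mem_iUnion] at h1
    obtain ⟨z, hz, hyz⟩ := h1
    refine mem_iUnion.2 ⟨⟨z, hz⟩, ?_⟩
    rw [mem_closedBall, dist_eq_norm]
    exact norm_sub_le_of_mem_closedCell hd
      (hS.isUnitIndex _ z (Finset.mem_filter.1 hz).1) hyz (hx _ _)
  · refine (Filter.liminf_le_liminf (Filter.Eventually.of_forall hbound)).trans_eq ?_
    exact Filter.liminf_const _

lemma cthickening_subset_slab {d m : ℕ} {V : AffineSubspace ℝ (Pt d)}
    (hV : (V : Set (Pt d)).Nonempty) (hm : Module.finrank ℝ V.direction + m = d) {w : ℝ} (hw : 0 < w) :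
    ∃ (E : Fin m → Pt d) (p : Fin m → ℝ), Orthonormal ℝ E ∧
      cthickening w (V : Set (Pt d)) ⊆ slab E p w := by
  obtain ⟨v₀, hv₀⟩ := hV
  have hfin : Module.finrank ℝ (V.directionᗮ : Submodule ℝ (Pt d)) = m := by
    have := V.direction.finrank_add_finrank_orthogonal
    rw [finrank_euclideanSpace_fin] at this
    omega
  let b := (stdOrthonormalBasis ℝ V.directionᗮ).reindex (finCongr hfin)
  have hE : Orthonormal ℝ fun j => (b j : Pt d) :=
    b.orthonormal.comp_linearIsometry V.directionᗮ.subtypeₗᵢ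
  refine ⟨fun j => b j, fun j => inner ℝ (b j : Pt d) v₀, hE, fun x hx j => ?_⟩
  refine le_of_forall_pos_lt_add fun ε hε => ?_
  obtain ⟨v, hv, hxv⟩ := mem_thickening_iff.1
    (cthickening_subset_thickening' (by positivity) (lt_add_of_pos_right w hε) _ hx)
  have h1 : inner ℝ (b j : Pt d) (v - v₀) = 0 :=
    V.direction.inner_left_of_mem_orthogonal (AffineSubspace.vsub_mem_direction hv hv₀) (b j).2
  have h2 := abs_real_inner_le_norm (b j : Pt d) (x - v)
  rw [hE.1 j, one_mul, ← dist_eq_norm] at h2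
  refine lt_of_le_of_lt (le_of_eq_of_le ?_ h2) hxv
  rw [inner_sub_right] at h1 ⊢
  congr 1
  linarith

/-- Gauge functions satisfying a summability condition are the gauges of compact sets of finite
positive measure without tube null subsets of positive measure. -/
lemma exists_isCompact_forall_not_gTubeNull {d m k : ℕ} (hdmk : d = m + k) (hk : 1 ≤ k)
    {h : ℝ → ℝ} (hh : IsGauge d h)
    (hsum : Summable fun n : ℕ => √((n + 1) * 2 ^ (n * m) * h ((2 ^ n)⁻¹))) :
    ∃ A : Set (Pt d), IsCompact A ∧ 0 < gMeasure h A ∧ gMeasure h A < ⊤ ∧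
      ∀ B : Set (Pt d), B ⊆ A → 0 < gMeasure h B → ¬ GTubeNull d k B := by
  have hd : 0 < d := by omega
  have hstep : ∀ n : ℕ, ((2 : ℝ) ^ n)⁻¹ = 2 * (2 ^ (n + 1))⁻¹ := fun n => by
    rw [pow_succ]; field_simp
  obtain ⟨S, M, h0, hM, hunit, hpar, hcard, hspread, hN⟩ := exists_spread_sequence hdmk hk
    (fun n => h ((2 ^ n)⁻¹)) (fun n => hh.pos _ (by positivity))
    (fun n => hh.mono _ _ (by positivity) (by
      rw [hstep n]
      exact le_mul_of_one_le_left (by positivity) (by norm_num)))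
    (fun n => by
      have := hh.doubling ((2 ^ (n + 1))⁻¹) (by positivity)
      rwa [← hstep n] at this) hsum
  have hc : (0 : ℝ) < h ((2 ^ 0)⁻¹) / 2 ^ d := div_pos (hh.pos _ (by positivity)) (by positivity)
  have hS : IsCellTree S := by
    refine ⟨h0, hunit, hpar, hcard, fun n => ?_⟩
    by_contra hcon
    have h1 := hc.trans_le (hN n).1
    rw [Nat.eq_zero_of_not_pos hcon] at h1
    simp at h1
  obtain ⟨C, hC, hslab⟩ := hS.gMeasure_limitSet_inter_le hd hh (by linarith) hspread
    fun n => (hN n).2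
  refine ⟨limitSet S, hS.isCompact_limitSet hd, hS.gMeasure_limitSet_pos hd hh hc
    fun n => (hN n).1, ?_, fun B hB hB0 hnull => ?_⟩
  · let E : Fin m → Pt d := fun j => EuclideanSpace.basisFun (Fin d) ℝ (Fin.castLE (by omega) j)
    have hE : Orthonormal ℝ E := (EuclideanSpace.basisFun (Fin d) ℝ).orthonormal.comp _
      (Fin.castLE_injective _)
    have hR := one_le_cellRadius hd
    have h1 := hslab E 0 (cellRadius d) hE (by linarith)
    rw [inter_eq_left.2] at h1
    · exact h1.trans_lt ENNReal.ofReal_lt_top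
    · intro x hx j
      have h2 := abs_real_inner_le_norm (E j) x
      rw [hE.1 j, one_mul] at h2
      simpa using h2.trans (hS.norm_le_of_mem_limitSet hd hx)
  · refine hB0.not_ge (ENNReal.le_of_forall_pos_le_add fun ε hε _ => ?_)
    rw [zero_add]
    obtain ⟨T, w, hT, hBT, hw⟩ := hnull (ε / (C + 1)) (by positivity)
    have hTm : ∀ n, gMeasure h (limitSet S ∩ T n) ≤ ENNReal.ofReal C *
        ENNReal.ofReal (w n) ^ (d - k) := by
      intro n
      obtain ⟨hwn, L, ⟨V, hV, hVk, rfl⟩, hTn⟩ := hT n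
      obtain ⟨E, p, hE, hsub⟩ := cthickening_subset_slab (m := m) hV (by omega) hwn
      rw [hTn]
      refine (measure_mono (inter_subset_inter_right _ hsub)).trans ((hslab E p _ hE hwn).trans_eq ?_)
      rw [ENNReal.ofReal_mul hC, ENNReal.ofReal_pow hwn.le, show d - k = m by omega]
    calc gMeasure h B ≤ gMeasure h (⋃ n, limitSet S ∩ T n) := by
          refine measure_mono ?_
          rw [← inter_iUnion]
          exact subset_inter hB hBT
      _ ≤ ∑' n, gMeasure h (limitSet S ∩ T n) := measure_iUnion_le _
      _ ≤ ∑' n, ENNReal.ofReal C * ENNReal.ofReal (w n) ^ (d - k) := ENNReal.tsum_le_tsum hTm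
      _ = ENNReal.ofReal C * ∑' n, ENNReal.ofReal (w n) ^ (d - k) := ENNReal.tsum_mul_left
      _ ≤ ENNReal.ofReal C * ENNReal.ofReal (ε / (C + 1)) := by gcongr
      _ = ENNReal.ofReal (C * (ε / (C + 1))) := (ENNReal.ofReal_mul hC).symm
      _ ≤ ENNReal.ofReal ε := by
        refine ENNReal.ofReal_le_ofReal ?_
        rw [← mul_div_assoc, div_le_iff₀ (by positivity)]
        have : (0 : ℝ) < ε := hε
        nlinarith
      _ = ε := ENNReal.ofReal_coe_nnreal

/-- The dyadic form of the integrability condition on a gauge. -/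
lemma IsGauge.summable_of_integrableOn {d m k : ℕ} (hdmk : d = m + k) {h : ℝ → ℝ}
    (hh : IsGauge d h)
    (hint : IntegrableOn (fun t => t⁻¹ * √(t ^ ((k : ℝ) - d) * |Real.log t| * h t))
      (Ioo 0 1) volume) :
    Summable fun n : ℕ => √((n + 1) * 2 ^ (n * m) * h ((2 ^ n)⁻¹)) := by
  set f : ℝ → ℝ := fun t => t⁻¹ * √(t ^ ((k : ℝ) - d) * |Real.log t| * h t) with hf
  let I : ℕ → Set ℝ := fun n => Ioo ((2 ^ (n + 2))⁻¹) ((2 ^ (n + 1))⁻¹)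
  have hanti : Antitone fun n : ℕ => ((2 : ℝ) ^ (n + 1))⁻¹ := fun a b hab => by
    dsimp only
    gcongr
    norm_num
  have hdisj : Pairwise (Function.onFun Disjoint I) := hanti.pairwise_disjoint_on_Ioo_succ
  have hIsub : ∀ n, I n ⊆ Ioo 0 1 := fun n t ht =>
    ⟨(by positivity : (0 : ℝ) < (2 ^ (n + 2))⁻¹).trans ht.1,
      ht.2.trans_le (inv_le_one_of_one_le₀ (one_le_pow₀ (by norm_num)))⟩
  have hsum := (hasSum_integral_iUnion (fun n => measurableSet_Ioo) hdisj
    (hint.mono_set (iUnion_subset hIsub))).summable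
  rw [← summable_nat_add_iff 2]
  refine Summable.of_nonneg_of_le (fun n => Real.sqrt_nonneg _) (fun n => ?_)
    (hsum.mul_left (2 * √(6 * 2 ^ m)))
  have hconst : ∀ t ∈ I n, 2 ^ (n + 1) *
      √(2 ^ ((n + 1) * m) * ((n + 1) / 2) * h ((2 ^ (n + 2))⁻¹)) ≤ f t := by
    intro t ht
    have ht0 : 0 < t := (hIsub n ht).1
    have hinv : 2 ^ (n + 1) ≤ t⁻¹ := by
      rw [le_inv_comm₀ (by positivity) ht0]
      exact ht.2.le
    have e1 : t ^ ((k : ℝ) - d) = t⁻¹ ^ m := by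
      rw [show (k : ℝ) - d = -(m : ℝ) by rw [hdmk]; push_cast; ring, Real.rpow_neg ht0.le,
        Real.rpow_natCast, inv_pow]
    have e2 : ((n : ℝ) + 1) / 2 ≤ |Real.log t| := by
      have h1 := Real.log_le_log ht0 ht.2.le
      rw [Real.log_inv, Real.log_pow] at h1
      have h2 := neg_le_abs (Real.log t)
      have h3 := Real.log_two_gt_d9
      push_cast at h1
      nlinarith [(Nat.cast_nonneg n : (0 : ℝ) ≤ n)]
    have e3 : (0 : ℝ) ≤ h ((2 ^ (n + 2))⁻¹) := (hh.pos _ (by positivity)).le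
    simp only [hf]
    rw [e1]
    refine mul_le_mul hinv (Real.sqrt_le_sqrt ?_) (Real.sqrt_nonneg _) (by positivity)
    rw [pow_mul]
    have e4 := hh.mono _ _ (by positivity) ht.1.le
    gcongr
  have h1 := setIntegral_ge_of_const_le_real measurableSet_Ioo (by simp) hconst
    (hint.mono_set (hIsub n))
  have hvol : volume.real (I n) = (2 ^ (n + 2))⁻¹ := by
    rw [Real.volume_real_Ioo_of_le (hanti (Nat.le_succ n)), Nat.succ_eq_add_one,
      pow_succ _ (n + 1)]
    field_simp
    ring
  rw [hvol] at h1
  calc √(((n + 2 : ℕ) + 1) * 2 ^ ((n + 2) * m) * h ((2 ^ (n + 2))⁻¹))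
      ≤ √(6 * 2 ^ m * (2 ^ ((n + 1) * m) * ((n + 1) / 2) * h ((2 ^ (n + 2))⁻¹))) := by
        refine Real.sqrt_le_sqrt ?_
        have e3 : (0 : ℝ) ≤ h ((2 ^ (n + 2))⁻¹) := (hh.pos _ (by positivity)).le
        rw [show (n + 2) * m = m + (n + 1) * m by ring, pow_add]
        push_cast
        have : (n : ℝ) + 2 + 1 ≤ 3 * (n + 1) := by linarith [(Nat.cast_nonneg n : (0 : ℝ) ≤ n)]
        calc ((n : ℝ) + 2 + 1) * (2 ^ m * 2 ^ ((n + 1) * m)) * h ((2 ^ (n + 2))⁻¹)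
            ≤ (3 * (n + 1)) * (2 ^ m * 2 ^ ((n + 1) * m)) * h ((2 ^ (n + 2))⁻¹) := by gcongr
          _ = _ := by ring
    _ = 2 * √(6 * 2 ^ m) * (2 ^ (n + 1) *
      √(2 ^ ((n + 1) * m) * ((n + 1) / 2) * h ((2 ^ (n + 2))⁻¹)) * (2 ^ (n + 2))⁻¹) := by
        rw [Real.sqrt_mul (by positivity), pow_succ _ (n + 1)]
        field_simp
    _ ≤ _ := by gcongr

/-- A gauge of dimension `m` with a logarithmic correction. -/
def logGauge (m : ℕ) (t : ℝ) : ℝ := t ^ m / (6 + max 0 (-Real.log t)) ^ 6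

lemma six_le_six_add_max (t : ℝ) : 6 ≤ 6 + max 0 (-Real.log t) :=
  le_add_of_nonneg_right (le_max_left _ _)

lemma logGauge_le (m : ℕ) {t : ℝ} (ht : 0 ≤ t) : logGauge m t ≤ t ^ m :=
  div_le_self (by positivity) (one_le_pow₀ (by linarith [six_le_six_add_max t]))

lemma isGauge_logGauge {d m k : ℕ} (hdmk : d = m + k) (hk : 1 ≤ k) (hm : 1 ≤ m) :
    IsGauge d (logGauge m) where
  pos t ht := by
    have := six_le_six_add_max t
    unfold logGauge
    positivity
  mono s t hs hst := by
    have := six_le_six_add_max t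
    unfold logGauge
    have := Real.log_le_log hs hst
    have ht : 0 < t := hs.trans_le hst
    gcongr
  tendsto := by
    have h1 : Filter.Tendsto (fun t : ℝ => t ^ m) (nhdsWithin 0 (Ioi 0)) (nhds 0) := by
      have := ((continuous_pow m).tendsto (0 : ℝ)).mono_left
        (nhdsWithin_le_nhds (s := Ioi (0 : ℝ)))
      rwa [zero_pow (by omega)] at this
    refine tendsto_of_tendsto_of_tendsto_of_le_of_le' tendsto_const_nhds h1 ?_ ?_
    · filter_upwards [self_mem_nhdsWithin] with t ht
      have h2 := six_le_six_add_max t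
      have h3 : (0 : ℝ) < t := ht
      unfold logGauge
      positivity
    · filter_upwards [self_mem_nhdsWithin] with t ht
      exact logGauge_le m (le_of_lt ht)
  doubling t ht := by
    have h1 := six_le_six_add_max t
    have h2 := six_le_six_add_max (2 * t)
    unfold logGauge
    set u := 6 + max 0 (-Real.log t)
    set v := 6 + max 0 (-Real.log (2 * t)) with hv
    have huv : u ≤ 1.12 * v := by
      have h3 : max 0 (-Real.log t) ≤ max 0 (-Real.log (2 * t)) + 0.7 := by
        refine max_le (by positivity) ?_
        refine le_trans ?_ (add_le_add_left (le_max_right _ _) _)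
        rw [Real.log_mul two_ne_zero ht.ne']
        linarith [Real.log_two_lt_d9]
      linarith
    have h4 : u ^ 6 ≤ 2 * v ^ 6 := by
      calc u ^ 6 ≤ (1.12 * v) ^ 6 := by gcongr
        _ = 1.12 ^ 6 * v ^ 6 := mul_pow _ _ _
        _ ≤ 2 * v ^ 6 := by gcongr; norm_num
    have h5 : (2 : ℝ) ^ m * 2 ≤ 2 ^ d := by
      rw [← pow_succ]
      exact pow_le_pow_right₀ (by norm_num) (by omega)
    rw [mul_pow, ← mul_div_assoc, div_le_div_iff₀ (by positivity) (by positivity)]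
    calc 2 ^ m * t ^ m * u ^ 6 ≤ 2 ^ m * t ^ m * (2 * v ^ 6) := by gcongr
      _ = 2 ^ m * 2 * (t ^ m * v ^ 6) := by ring
      _ ≤ 2 ^ d * (t ^ m * v ^ 6) := by gcongr
      _ = _ := by ring

lemma summable_logGauge (m : ℕ) :
    Summable fun n : ℕ => √((n + 1) * 2 ^ (n * m) * logGauge m ((2 ^ n)⁻¹)) := by
  have h1 : Summable fun n : ℕ => 8 * (1 / ((n + 1 : ℕ) : ℝ) ^ 2) :=
    ((summable_nat_add_iff 1).2 (Real.summable_one_div_nat_pow.2 one_lt_two)).mul_left 8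
  refine Summable.of_nonneg_of_le (fun n => Real.sqrt_nonneg _) (fun n => ?_) h1
  rw [Real.sqrt_le_iff]
  refine ⟨by positivity, ?_⟩
  have h2 : ((n : ℝ) + 1) / 2 ≤ 6 + max 0 (-Real.log ((2 ^ n)⁻¹)) := by
    have := le_max_right 0 (-Real.log (((2 : ℝ) ^ n)⁻¹))
    rw [Real.log_inv, Real.log_pow, neg_neg] at *
    have h3 := Real.log_two_gt_d9
    nlinarith [(Nat.cast_nonneg n : (0 : ℝ) ≤ n)]
  unfold logGauge
  push_cast
  have h3 : ((2 : ℝ) ^ n)⁻¹ ^ m = (2 ^ (n * m))⁻¹ := by rw [inv_pow, pow_mul]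
  calc ((n : ℝ) + 1) * 2 ^ (n * m) *
        (((2 : ℝ) ^ n)⁻¹ ^ m / (6 + max 0 (-Real.log ((2 ^ n)⁻¹))) ^ 6)
      ≤ ((n : ℝ) + 1) * 2 ^ (n * m) * (((2 : ℝ) ^ n)⁻¹ ^ m / (((n : ℝ) + 1) / 2) ^ 6) := by gcongr
    _ = 64 / ((n : ℝ) + 1) ^ 5 := by
      rw [h3]
      field_simp
      norm_num
    _ ≤ 64 / ((n : ℝ) + 1) ^ 4 := by
      gcongr
      · linarith [(Nat.cast_nonneg n : (0 : ℝ) ≤ n)]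
      · norm_num
    _ = _ := by
      field_simp
      norm_num

lemma exists_rpow_le_logGauge (m : ℕ) {s : ℝ} (hs : (m : ℝ) < s) :
    ∃ C : ℝ, 0 < C ∧ ∀ t : ℝ, 0 < t → t < 1 → t ^ s ≤ C * logGauge m t := by
  set η := (s - m) / 6 with hη
  have hη0 : 0 < η := div_pos (sub_pos.2 hs) (by norm_num)
  refine ⟨(6 + 1 / η) ^ 6, by positivity, fun t ht ht1 => ?_⟩
  have hlog := Real.log_neg ht ht1
  have h6 := six_le_six_add_max t
  have h1 : 6 + max 0 (-Real.log t) ≤ (6 + 1 / η) * t ^ (-η) := by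
    rw [max_eq_right (by linarith)]
    have h2 := Real.log_le_rpow_div (inv_pos.2 ht).le hη0
    rw [Real.log_inv, Real.inv_rpow ht.le, ← Real.rpow_neg ht.le] at h2
    have h3 : 1 ≤ t ^ (-η) := Real.one_le_rpow_of_pos_of_le_one_of_nonpos ht ht1.le (by linarith)
    calc 6 + -Real.log t ≤ 6 * t ^ (-η) + t ^ (-η) / η := by linarith
      _ = _ := by ring
  have h2 : (6 + max 0 (-Real.log t)) ^ 6 ≤ (6 + 1 / η) ^ 6 * t ^ (-(s - m)) := by
    refine (pow_le_pow_left₀ (by linarith) h1 6).trans_eq ?_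
    rw [mul_pow, ← Real.rpow_mul_natCast ht.le]
    congr 2
    rw [hη]
    push_cast
    ring
  unfold logGauge
  rw [← mul_div_assoc, le_div_iff₀ (by positivity)]
  calc t ^ s * (6 + max 0 (-Real.log t)) ^ 6
      ≤ t ^ s * ((6 + 1 / η) ^ 6 * t ^ (-(s - m))) := by gcongr
    _ = (6 + 1 / η) ^ 6 * (t ^ s * t ^ (-(s - m))) := by ring
    _ = _ := by
      rw [← Real.rpow_add ht, show s + -(s - m) = (m : ℝ) by ring, Real.rpow_natCast]

lemma dimH_eq_of_gMeasure_logGauge {d m : ℕ} (hm : 1 ≤ m) {A : Set (Pt d)}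
    (h0 : 0 < gMeasure (logGauge m) A) (h1 : gMeasure (logGauge m) A < ⊤) : dimH A = m := by
  have hpos : ∀ r : ℝ≥0∞, r < 1 → r ≠ 0 → 0 < r.toReal ∧ r.toReal < 1 := by
    intro r hr hr0
    have hlt := (ENNReal.toReal_lt_toReal hr.ne_top ENNReal.one_ne_top).2 hr
    rw [ENNReal.toReal_one] at hlt
    exact ⟨ENNReal.toReal_pos hr0 hr.ne_top, hlt⟩
  have hnear : Iio (1 : ℝ≥0∞) ∈ nhdsWithin (0 : ℝ≥0∞) (Ici 0) :=
    mem_nhdsWithin_of_mem_nhds (Iio_mem_nhds one_pos)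
  refine le_antisymm ?_ ?_
  · refine ENNReal.le_of_forall_pos_le_add fun ε hε _ => ?_
    set s : ℝ≥0 := m + ε with hs
    obtain ⟨C, hC, hle⟩ := exists_rpow_le_logGauge m (s := s) (by
      rw [hs]; push_cast; have : (0 : ℝ) < ε := hε; linarith)
    have h2 : μH[s] A ≤ ENNReal.ofReal C * gMeasure (logGauge m) A := by
      refine Measure.mkMetric_mono_smul ENNReal.ofReal_ne_top (ENNReal.ofReal_pos.2 hC).ne' ?_ A
      filter_upwards [hnear] with r hr
      rcases eq_or_ne r 0 with rfl | hr0
      · rw [ENNReal.zero_rpow_of_pos]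
        · exact zero_le
        · have : (0 : ℝ) < ε := hε
          rw [hs]
          positivity
      · obtain ⟨e1, e2⟩ := hpos r hr hr0
        rw [Pi.smul_apply, smul_eq_mul, ← ENNReal.ofReal_mul hC.le]
        refine le_trans (le_of_eq ?_) (ENNReal.ofReal_le_ofReal (hle _ e1 e2))
        rw [← ENNReal.ofReal_rpow_of_pos e1, ENNReal.ofReal_toReal (ne_top_of_lt hr)]
    have h3 := dimH_le_of_hausdorffMeasure_ne_top
      (h2.trans_lt (ENNReal.mul_lt_top ENNReal.ofReal_lt_top h1)).ne
    rw [hs] at h3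
    exact_mod_cast h3
  · have h2 : gMeasure (logGauge m) A ≤ μH[((m : ℝ≥0) : ℝ)] A := by
      have := Measure.mkMetric_mono_smul (X := Pt d) ENNReal.one_ne_top one_ne_zero
        (m₁ := fun r : ℝ≥0∞ => ENNReal.ofReal (logGauge m r.toReal))
        (m₂ := fun r : ℝ≥0∞ => r ^ ((m : ℝ≥0) : ℝ)) ?_ A
      · rwa [one_smul] at this
      filter_upwards [hnear] with r hr
      rw [one_smul, NNReal.coe_natCast, ENNReal.rpow_natCast]
      refine (ENNReal.ofReal_le_ofReal (logGauge_le m ENNReal.toReal_nonneg)).trans_eq ?_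
      rw [ENNReal.ofReal_pow ENNReal.toReal_nonneg, ENNReal.ofReal_toReal (ne_top_of_lt hr)]
    have h3 := le_dimH_of_hausdorffMeasure_ne_zero (h0.trans_le h2).ne'
    exact_mod_cast h3

theorem statement8 (d k : ℕ) (hd : 2 ≤ d) (hk1 : 1 ≤ k) (hk2 : k ≤ d - 1)
    (h : ℝ → ℝ)
    (hpos : ∀ t : ℝ, 0 < t → 0 < h t)
    (hmono : ∀ s t : ℝ, 0 < s → s ≤ t → h s ≤ h t)
    (hcont : ContinuousOn h (Set.Ioi 0))
    (hlim : Filter.Tendsto h (nhdsWithin 0 (Set.Ioi 0)) (nhds 0))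
    (hdoub : ∀ t : ℝ, 0 < t → h (2 * t) ≤ 2 ^ d * h t)
    (hint : IntegrableOn
      (fun t => t⁻¹ * Real.sqrt (t ^ ((k : ℝ) - d) * |Real.log t| * h t))
      (Set.Ioo 0 1) volume) :
    (∃ A : Set (Pt d), IsCompact A ∧ 0 < gMeasure h A ∧ gMeasure h A < ⊤ ∧
      ∀ B : Set (Pt d), B ⊆ A → MeasurableSet B → 0 < gMeasure h B →
        ¬ GTubeNull d k B) ∧
    (∃ A' : Set (Pt d), dimH A' = (d : ℝ≥0∞) - k ∧ ¬ GTubeNull d k A') := by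
  obtain ⟨m, hdmk⟩ : ∃ m, d = m + k := ⟨d - k, by omega⟩
  have hm : 1 ≤ m := by omega
  refine ⟨?_, ?_⟩
  · have hh : IsGauge d h := ⟨hpos, hmono, hlim, hdoub⟩
    obtain ⟨A, hA, h0, h1, hB⟩ := exists_isCompact_forall_not_gTubeNull hdmk hk1 hh
      (hh.summable_of_integrableOn hdmk hint)
    exact ⟨A, hA, h0, h1, fun B hBA _ => hB B hBA⟩
  · obtain ⟨A, -, h0, h1, hB⟩ := exists_isCompact_forall_not_gTubeNull hdmk hk1
      (isGauge_logGauge hdmk hk1 hm) (summable_logGauge m)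
    refine ⟨A, ?_, hB A subset_rfl h0⟩
    rw [dimH_eq_of_gMeasure_logGauge hm h0 h1, hdmk, Nat.cast_add,
      ENNReal.add_sub_cancel_right (ENNReal.natCast_ne_top k)]
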